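/- arXiv:2203.16438 — 11 statements merged into one kernel-verified Lean document; each statement's English description precedes it below -/
import Mathlib

section
/- Lyapunov decrement for the Heavy Ball high-order tuner: if 0 < β < 2 and 0 < γ ≤ β(2−β)/8, then for every k ≥ 0, V_{k+1} − V_k ≤ −(11/8)‖θ_k − ϑ_k‖² − (21/32)(1/𝒩_k)⟨φ_k, ϑ_k − θ*⟩². In particular V_{k+1} ≤ V_k for all k. -/
open scoped RealInnerProductSpace

/-- One step of the Heavy Ball tuner, in error coordinates `e = ϑ - θ*` and `d = θ - ϑ`. -/
lemma heavyBall_step_norm_sq_le {E : Type*} [NormedAddCommGroup E] [InnerProductSpace ℝ E]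
    (φ d e : E) {c γ : ℝ} (hγ0 : 0 < γ) (hγ : γ ≤ (1 - c ^ 2) / 8) :
    ‖e - ((γ / (1 + ‖φ‖ ^ 2)) * ⟪φ, c • d + e⟫) • φ‖ ^ 2 +
        ‖c • d + ((γ / (1 + ‖φ‖ ^ 2)) * ⟪φ, c • d + e⟫) • φ‖ ^ 2 ≤
      ‖e‖ ^ 2 + ‖d‖ ^ 2 +
        γ * (-(11 / 8) * ‖d‖ ^ 2 - (21 / 32) * (1 / (1 + ‖φ‖ ^ 2)) * ⟪φ, e⟫ ^ 2) := by
  have hN : 0 < 1 + ‖φ‖ ^ 2 := by positivity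
  have hcs : ⟪φ, d⟫ ^ 2 ≤ ‖φ‖ ^ 2 * ‖d‖ ^ 2 := by
    rw [← mul_pow, sq_le_sq, abs_of_nonneg (by positivity : 0 ≤ ‖φ‖ * ‖d‖)]
    exact abs_real_inner_le_norm φ d
  have ha : 0 < 1 / (1 + ‖φ‖ ^ 2) := by positivity
  have hap : 1 / (1 + ‖φ‖ ^ 2) * ‖φ‖ ^ 2 ≤ 1 := by
    rw [one_div_mul_eq_div, div_le_one hN]; linarith
  rw [norm_sub_sq_real, norm_add_sq_real, div_eq_mul_one_div γ]
  simp only [norm_smul, mul_pow, Real.norm_eq_abs, sq_abs, inner_smul_right,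
    inner_add_right, real_inner_comm φ]
  generalize 1 / (1 + ‖φ‖ ^ 2) = a at *
  generalize ⟪φ, d⟫ = t at *
  generalize ⟪φ, e⟫ = s at *
  have hp : 0 ≤ ‖φ‖ ^ 2 := by positivity
  generalize ‖φ‖ ^ 2 = p at *
  have hD : 0 ≤ ‖d‖ ^ 2 := by positivity
  generalize ‖d‖ ^ 2 = D at *
  have hc : c ^ 2 ≤ 1 := by linarith
  obtain ⟨u, rfl⟩ : ∃ u, s = u - c * t := ⟨c * t + s, by ring⟩
  have hw : a * (c * t) ^ 2 ≤ D := calc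
    a * (c * t) ^ 2 = c ^ 2 * (a * t ^ 2) := by ring
    _ ≤ 1 * (a * t ^ 2) := by gcongr
    _ ≤ 1 * (a * (p * D)) := by gcongr
    _ = (a * p) * D := by ring
    _ ≤ 1 * D := by gcongr
    _ = D := one_mul D
  have hu : γ * (a * p) * (a * u ^ 2) ≤ 1 / 8 * 1 * (a * u ^ 2) := by
    have : γ ≤ 1 / 8 := by nlinarith [sq_nonneg c]
    gcongr
  have hq : a * (-(7 / 4) * u ^ 2 + 4 * u * (c * t) + 21 / 32 * (u - c * t) ^ 2) ≤
      a * (3 * (c * t) ^ 2) := by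
    gcongr
    nlinarith [sq_nonneg (35 * u - 43 * (c * t)), sq_nonneg (c * t)]
  have hd : 8 * γ * D ≤ (1 - c ^ 2) * D := by gcongr; linarith
  have key : -2 * a * u * (u - c * t) + 2 * (γ * (a * p) * (a * u ^ 2)) + 2 * a * u * (c * t)
      - 8 * D ≤ -(11 / 8) * D - 21 / 32 * a * (u - c * t) ^ 2 := by
    linarith
  linear_combination γ * key + hd

theorem hb_lyapunov_decrement
    (n : ℕ) (hn : 1 ≤ n)
    (θstar : EuclideanSpace ℝ (Fin n))
    (φ θ ϑ : ℕ → EuclideanSpace ℝ (Fin n))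
    (β γ : ℝ) (hβ0 : 0 < β) (hβ2 : β < 2)
    (hγ0 : 0 < γ) (hγ : γ ≤ β * (2 - β) / 8)
    (hθ : ∀ k, θ (k + 1) = θ k - β • (θ k - ϑ k))
    (hϑ : ∀ k, ϑ (k + 1) =
      ϑ k - ((γ / (1 + ‖φ k‖ ^ 2)) * ⟪φ k, θ (k + 1) - θstar⟫) • φ k)
    (V : ℕ → ℝ)
    (hV : ∀ k, V k = (1 / γ) * ‖ϑ k - θstar‖ ^ 2 + (1 / γ) * ‖θ k - ϑ k‖ ^ 2)
    :
    (∀ k, V (k + 1) - V k ≤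
      -(11 / 8) * ‖θ k - ϑ k‖ ^ 2 -
        (21 / 32) * (1 / (1 + ‖φ k‖ ^ 2)) * ⟪φ k, ϑ k - θstar⟫ ^ 2) ∧
    (∀ k, V (k + 1) ≤ V k) := by
  have decrement : ∀ k, V (k + 1) - V k ≤
      -(11 / 8) * ‖θ k - ϑ k‖ ^ 2 -
        (21 / 32) * (1 / (1 + ‖φ k‖ ^ 2)) * ⟪φ k, ϑ k - θstar⟫ ^ 2 := by
    intro k
    have h := heavyBall_step_norm_sq_le (φ k) (θ k - ϑ k) (ϑ k - θstar) (c := 1 - β) hγ0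
      (by linarith)
    have hθ' : θ (k + 1) - θstar = (1 - β) • (θ k - ϑ k) + (ϑ k - θstar) := by
      rw [hθ]; module
    rw [← hθ'] at h
    have he : ϑ (k + 1) - θstar = ϑ k - θstar -
        ((γ / (1 + ‖φ k‖ ^ 2)) * ⟪φ k, θ (k + 1) - θstar⟫) • φ k := by
      rw [hϑ]; abel
    have hd : θ (k + 1) - ϑ (k + 1) = (1 - β) • (θ k - ϑ k) +
        ((γ / (1 + ‖φ k‖ ^ 2)) * ⟪φ k, θ (k + 1) - θstar⟫) • φ k := by
      rw [← sub_sub_sub_cancel_right _ _ θstar, he, hθ']; abel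
    rw [← he, ← hd] at h
    rw [hV, hV, ← mul_add, ← mul_add, ← mul_sub, one_div_mul_eq_div, div_le_iff₀' hγ0]
    linarith
  refine ⟨decrement, fun k => sub_nonpos.mp ((decrement k).trans ?_)⟩
  have h₁ : 0 ≤ ‖θ k - ϑ k‖ ^ 2 := by positivity
  have h₂ : 0 ≤ (21 / 32) * (1 / (1 + ‖φ k‖ ^ 2)) * ⟪φ k, ϑ k - θstar⟫ ^ 2 := by positivity
  linarith
end

section
/- Summed Lyapunov decrement for the Heavy Ball tuner over a window: if 0 < β < 2 and 0 < γ ≤ β(2−β)/8, then for every integer k ≥ ΔT (ΔT ≥ 1), V_k − V_{k−ΔT} ≤ −(11/8)(1/ΔT)·W₁² − (21/32)(1/ΔT)·W₂². -/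
open scoped RealInnerProductSpace

/-- One step of the Heavy Ball tuner, in the error coordinates `a = ϑ - θ*` and `d = θ - ϑ`,
decreases `‖a‖ ^ 2 + ‖d‖ ^ 2`. -/
theorem heavyBall_step_decrement {E : Type*} [NormedAddCommGroup E] [InnerProductSpace ℝ E]
    (a d φ : E) {β γ t : ℝ}
    (hγ0 : 0 < γ) (hγ : γ ≤ β * (2 - β) / 8)
    (ht : t = γ / (1 + ‖φ‖ ^ 2) * ⟪φ, a + (1 - β) • d⟫) :
    ‖a - t • φ‖ ^ 2 + ‖(1 - β) • d + t • φ‖ ^ 2 - (‖a‖ ^ 2 + ‖d‖ ^ 2) ≤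
      -(γ * (11 / 8 * ‖d‖ ^ 2 + 21 / 32 * (⟪φ, a⟫ ^ 2 / (1 + ‖φ‖ ^ 2)))) := by
  have hN : 0 < 1 + ‖φ‖ ^ 2 := by positivity
  have hQ : ⟪φ, d⟫ ^ 2 ≤ ‖φ‖ ^ 2 * ‖d‖ ^ 2 := by
    rw [← mul_pow, sq_le_sq, abs_of_nonneg (by positivity : 0 ≤ ‖φ‖ * ‖d‖)]
    exact abs_real_inner_le_norm φ d
  rw [norm_sub_sq_real, norm_add_sq_real]
  simp only [inner_smul_right, norm_smul, mul_pow, Real.norm_eq_abs, sq_abs,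
    inner_add_right, real_inner_comm φ] at ht ⊢
  rw [div_eq_mul_inv (⟪φ, a⟫ ^ 2)]
  rw [div_eq_mul_inv] at ht
  have hmN : (1 + ‖φ‖ ^ 2)⁻¹ * (1 + ‖φ‖ ^ 2) = 1 := inv_mul_cancel₀ hN.ne'
  have hm : 0 < (1 + ‖φ‖ ^ 2)⁻¹ := inv_pos.2 hN
  generalize (1 + ‖φ‖ ^ 2)⁻¹ = m at *
  generalize ⟪φ, a⟫ = P at *
  generalize ⟪φ, d⟫ = Q at *
  have hS : 0 ≤ ‖φ‖ ^ 2 := by positivity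
  have hD : 0 ≤ ‖d‖ ^ 2 := by positivity
  generalize ‖φ‖ ^ 2 = S at *
  generalize ‖d‖ ^ 2 = D at *
  have hc : (1 - β) ^ 2 ≤ 1 - 8 * γ := by nlinarith
  have hmS : m * S ≤ 1 := by nlinarith
  have hmQ : m * Q ^ 2 ≤ D := by
    nlinarith [mul_le_mul_of_nonneg_left hQ hm.le, mul_le_mul_of_nonneg_right hmS hD]
  have hR : m * ((1 - β) * Q) ^ 2 ≤ D := by
    have : 0 ≤ m * Q ^ 2 := by positivity
    nlinarith
  have hγ8 : γ ≤ 1 / 8 := by nlinarith [sq_nonneg (1 - β)]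
  have hcD : (1 - β) ^ 2 * D ≤ (1 - 8 * γ) * D := mul_le_mul_of_nonneg_right hc hD
  generalize hRdef : (1 - β) * Q = R at *
  have htS : t ^ 2 * S ≤ γ / 8 * (m * (P + R) ^ 2) := by
    calc t ^ 2 * S = γ * (γ * (m * (P + R) ^ 2)) * (m * S) := by rw [ht]; ring
      _ ≤ γ * (γ * (m * (P + R) ^ 2)) * 1 := by gcongr
      _ ≤ γ * (1 / 8 * (m * (P + R) ^ 2)) * 1 := by gcongr
      _ = _ := by ring
  have hquad : -8 * D - 2 * m * (P ^ 2 - R ^ 2) + 1 / 4 * (m * (P + R) ^ 2) ≤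
      -(11 / 8 * D + 21 / 32 * (P ^ 2 * m)) := by
    nlinarith [mul_nonneg hm.le (sq_nonneg (P - R)), mul_nonneg hm.le (sq_nonneg P)]
  have hcross : -2 * (t * P) + 2 * (t * R) = γ * (-2 * m * (P ^ 2 - R ^ 2)) := by
    rw [ht]; ring
  have hγquad := mul_le_mul_of_nonneg_left hquad hγ0.le
  have hRt : (1 - β) * (t * Q) = t * R := by rw [← hRdef]; ring
  linarith

theorem hb_summed_decrement
    (n : ℕ) (hn : 1 ≤ n)
    (θstar : EuclideanSpace ℝ (Fin n))
    (φ θ ϑ : ℕ → EuclideanSpace ℝ (Fin n))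
    (β γ : ℝ) (hβ0 : 0 < β) (hβ2 : β < 2)
    (hγ0 : 0 < γ) (hγ : γ ≤ β * (2 - β) / 8)
    (hθ : ∀ k, θ (k + 1) = θ k - β • (θ k - ϑ k))
    (hϑ : ∀ k, ϑ (k + 1) =
      ϑ k - ((γ / (1 + ‖φ k‖ ^ 2)) * ⟪φ k, θ (k + 1) - θstar⟫) • φ k)
    (V : ℕ → ℝ)
    (hV : ∀ k, V k = (1 / γ) * ‖ϑ k - θstar‖ ^ 2 + (1 / γ) * ‖θ k - ϑ k‖ ^ 2)
    (ΔT : ℕ) (hΔT : 1 ≤ ΔT) (k : ℕ) (hk : ΔT ≤ k)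
    (W₁ W₂ : ℝ)
    (hW₁ : W₁ = ∑ i ∈ Finset.Ico (k - ΔT) k, ‖θ i - ϑ i‖)
    (hW₂ : W₂ = ∑ i ∈ Finset.Ico (k - ΔT) k,
      (1 / Real.sqrt (1 + ‖φ i‖ ^ 2)) * |⟪φ i, ϑ i - θstar⟫|)
    :
    V k - V (k - ΔT) ≤
      -(11 / 8) * (1 / (ΔT : ℝ)) * W₁ ^ 2 - (21 / 32) * (1 / (ΔT : ℝ)) * W₂ ^ 2 := by
  have hstep : ∀ i, V (i + 1) - V i ≤ -(11 / 8) * ‖θ i - ϑ i‖ ^ 2 -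
      21 / 32 * ((1 / Real.sqrt (1 + ‖φ i‖ ^ 2)) * |⟪φ i, ϑ i - θstar⟫|) ^ 2 := by
    intro i
    have hθe : θ (i + 1) - θstar = (ϑ i - θstar) + (1 - β) • (θ i - ϑ i) := by
      rw [hθ]; module
    obtain ⟨t, ht⟩ : ∃ t, t = γ / (1 + ‖φ i‖ ^ 2) * ⟪φ i, θ (i + 1) - θstar⟫ := ⟨_, rfl⟩
    have hϑe : ϑ (i + 1) - θstar = (ϑ i - θstar) - t • φ i := by
      rw [hϑ, ← ht]; module
    have hde : θ (i + 1) - ϑ (i + 1) = (1 - β) • (θ i - ϑ i) + t • φ i := by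
      rw [hϑ, ← ht, hθ]; module
    rw [hθe] at ht
    have h := heavyBall_step_decrement _ _ _ hγ0 hγ ht
    rw [← hϑe, ← hde] at h
    have h' := mul_le_mul_of_nonneg_left h (one_div_pos.2 hγ0).le
    rw [mul_neg, ← mul_assoc (1 / γ) γ, one_div_mul_cancel hγ0.ne'] at h'
    rw [hV, hV, mul_pow, div_pow, sq_abs, Real.sq_sqrt (by positivity), one_pow,
      one_div_mul_eq_div (1 + ‖φ i‖ ^ 2)]
    linarith
  have hsum := Finset.sum_le_sum fun i (_ : i ∈ Finset.Ico (k - ΔT) k) => hstep i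
  rw [Finset.sum_Ico_sub V (Nat.sub_le k ΔT), Finset.sum_sub_distrib, ← Finset.mul_sum,
    ← Finset.mul_sum] at hsum
  have hcard : (Finset.Ico (k - ΔT) k).card = ΔT := by
    rw [Nat.card_Ico]; omega
  have hT : (0 : ℝ) < ΔT := by exact_mod_cast hΔT
  have hCS (f : ℕ → ℝ) : 1 / (ΔT : ℝ) * (∑ i ∈ Finset.Ico (k - ΔT) k, f i) ^ 2 ≤
      ∑ i ∈ Finset.Ico (k - ΔT) k, f i ^ 2 := by
    rw [one_div_mul_eq_div, div_le_iff₀' hT]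
    simpa [hcard] using sq_sum_le_card_mul_sum_sq (s := Finset.Ico (k - ΔT) k) (f := f)
  have h₁ := hCS fun i => ‖θ i - ϑ i‖
  have h₂ := hCS fun i => (1 / Real.sqrt (1 + ‖φ i‖ ^ 2)) * |⟪φ i, ϑ i - θstar⟫|
  rw [← hW₁] at h₁
  rw [← hW₂] at h₂
  linarith
end

section
/- Heavy Ball Case 1(a) contraction: suppose 0 < β < 2, 0 < γ ≤ β(2−β)/8, 0 < λ < 1, η > 0, and k ≥ ΔT. If ‖ϑ_{k−ΔT} − θ*‖² ≥ λγ V_{k−ΔT} and W₁ ≥ η‖ϑ_{k−ΔT} − θ*‖, then V_k ≤ (1 − (11/8)(λγη²/ΔT)) V_{k−ΔT}. -/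
open scoped RealInnerProductSpace

/-- One-step energy decrease of the Heavy Ball update, with `x = ϑ - θ*` and `d = θ - ϑ`. -/
theorem heavyBall_step {E : Type*} [NormedAddCommGroup E] [InnerProductSpace ℝ E]
    (x d f : E) (β γ : ℝ)
    (hγ0 : 0 < γ) (hγ : γ ≤ β * (2 - β) / 8) (e : ℝ) (he : e = ⟪f, x + (1 - β) • d⟫) :
    ‖x - (γ / (1 + ‖f‖ ^ 2) * e) • f‖ ^ 2 + ‖(1 - β) • d + (γ / (1 + ‖f‖ ^ 2) * e) • f‖ ^ 2
      ≤ ‖x‖ ^ 2 + ‖d‖ ^ 2 - 11 / 8 * γ * ‖d‖ ^ 2 := by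
  have hN : 0 < 1 + ‖f‖ ^ 2 := by positivity
  set g := γ / (1 + ‖f‖ ^ 2) with hg
  have hg0 : 0 < g := div_pos hγ0 hN
  have hgN : g * (1 + ‖f‖ ^ 2) = γ := div_mul_cancel₀ _ hN.ne'
  have hq : ⟪f, d⟫ ^ 2 ≤ ‖f‖ ^ 2 * ‖d‖ ^ 2 := by
    rw [← mul_pow]
    exact sq_le_sq.mpr ((abs_real_inner_le_norm f d).trans (le_abs_self _))
  rw [norm_sub_sq_real, norm_add_sq_real]
  simp only [norm_smul, mul_pow, Real.norm_eq_abs, sq_abs, real_inner_smul_left,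
    real_inner_smul_right]
  rw [real_inner_comm f x, real_inner_comm f d]
  rw [inner_add_right, real_inner_smul_right] at he
  have hx : ⟪f, x⟫ = e - (1 - β) * ⟪f, d⟫ := by linarith
  rw [hx]
  generalize ⟪f, d⟫ = q at *
  have hγ8 : γ ≤ 1 / 8 := by nlinarith [sq_nonneg (β - 1)]
  have hgf : g * ‖f‖ ^ 2 ≤ 1 / 8 := by linarith
  have hquad : g * e ^ 2 * (g * ‖f‖ ^ 2) ≤ g * e ^ 2 * (1 / 8) :=
    mul_le_mul_of_nonneg_left hgf (by positivity)
  have hsq : 0 ≤ g * (7 / 4 * e - 2 * (1 - β) * q) ^ 2 := by positivity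
  have ha : g * q ^ 2 * (1 - β) ^ 2 ≤ g * q ^ 2 * 1 :=
    mul_le_mul_of_nonneg_left (by nlinarith) (by positivity)
  have hgq : g * q ^ 2 ≤ γ * ‖d‖ ^ 2 := by
    rw [← hgN, mul_assoc]
    exact mul_le_mul_of_nonneg_left (by nlinarith [sq_nonneg ‖d‖]) hg0.le
  have hd : 8 * γ * ‖d‖ ^ 2 ≤ β * (2 - β) * ‖d‖ ^ 2 :=
    mul_le_mul_of_nonneg_right (by linarith) (by positivity)
  have hγd : 0 ≤ γ * ‖d‖ ^ 2 := by positivity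
  linarith

theorem hb_case1a
    (n : ℕ) (hn : 1 ≤ n)
    (θstar : EuclideanSpace ℝ (Fin n))
    (φ θ ϑ : ℕ → EuclideanSpace ℝ (Fin n))
    (β γ : ℝ) (hβ0 : 0 < β) (hβ2 : β < 2)
    (hγ0 : 0 < γ) (hγ : γ ≤ β * (2 - β) / 8)
    (hθ : ∀ k, θ (k + 1) = θ k - β • (θ k - ϑ k))
    (hϑ : ∀ k, ϑ (k + 1) =
      ϑ k - ((γ / (1 + ‖φ k‖ ^ 2)) * ⟪φ k, θ (k + 1) - θstar⟫) • φ k)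
    (V : ℕ → ℝ)
    (hV : ∀ k, V k = (1 / γ) * ‖ϑ k - θstar‖ ^ 2 + (1 / γ) * ‖θ k - ϑ k‖ ^ 2)
    (ΔT : ℕ) (hΔT : 1 ≤ ΔT) (k : ℕ) (hk : ΔT ≤ k)
    (W₁ W₂ : ℝ)
    (hW₁ : W₁ = ∑ i ∈ Finset.Ico (k - ΔT) k, ‖θ i - ϑ i‖)
    (hW₂ : W₂ = ∑ i ∈ Finset.Ico (k - ΔT) k,
      (1 / Real.sqrt (1 + ‖φ i‖ ^ 2)) * |⟪φ i, ϑ i - θstar⟫|)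
    (lam η : ℝ) (hlam0 : 0 < lam) (hlam1 : lam < 1) (hη : 0 < η)
    (hbig : lam * γ * V (k - ΔT) ≤ ‖ϑ (k - ΔT) - θstar‖ ^ 2)
    (hW1 : η * ‖ϑ (k - ΔT) - θstar‖ ≤ W₁) :
    V k ≤ (1 - (11 / 8) * (lam * γ * η ^ 2 / (ΔT : ℝ))) * V (k - ΔT) := by
  have hstep : ∀ j, V (j + 1) ≤ V j - 11 / 8 * ‖θ j - ϑ j‖ ^ 2 := by
    intro j
    have h := heavyBall_step (ϑ j - θstar) (θ j - ϑ j) (φ j) β γ hγ0 hγ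
      ⟪φ j, θ (j + 1) - θstar⟫ (by congr 1; rw [hθ j]; module)
    have h1 : ϑ (j + 1) - θstar = (ϑ j - θstar) -
        (γ / (1 + ‖φ j‖ ^ 2) * ⟪φ j, θ (j + 1) - θstar⟫) • φ j := by
      rw [hϑ j]; module
    have h2 : θ (j + 1) - ϑ (j + 1) = (1 - β) • (θ j - ϑ j) +
        (γ / (1 + ‖φ j‖ ^ 2) * ⟪φ j, θ (j + 1) - θstar⟫) • φ j := by
      rw [hϑ j]
      generalize γ / (1 + ‖φ j‖ ^ 2) * ⟪φ j, θ (j + 1) - θstar⟫ = c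
      rw [hθ j]; module
    rw [← h1, ← h2] at h
    have h3 := mul_le_mul_of_nonneg_left h (one_div_pos.mpr hγ0).le
    have h4 : 1 / γ * (11 / 8 * γ * ‖θ j - ϑ j‖ ^ 2) = 11 / 8 * ‖θ j - ϑ j‖ ^ 2 := by
      field_simp
    rw [hV, hV]
    linarith
  have htele : V k ≤ V (k - ΔT) -
      11 / 8 * ∑ i ∈ Finset.Ico (k - ΔT) k, ‖θ i - ϑ i‖ ^ 2 := by
    have h : ∀ j, k - ΔT ≤ j → V j ≤ V (k - ΔT) -
        11 / 8 * ∑ i ∈ Finset.Ico (k - ΔT) j, ‖θ i - ϑ i‖ ^ 2 := by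
      intro j hj
      induction j, hj using Nat.le_induction with
      | base => simp
      | succ j hj ih =>
        rw [Finset.sum_Ico_succ_top hj]
        linarith [hstep j]
    exact h k (Nat.sub_le _ _)
  have hT : (0 : ℝ) < ΔT := by exact_mod_cast hΔT
  have hCS : W₁ ^ 2 ≤ ΔT * ∑ i ∈ Finset.Ico (k - ΔT) k, ‖θ i - ϑ i‖ ^ 2 := by
    have h := sq_sum_le_card_mul_sum_sq (s := Finset.Ico (k - ΔT) k)
      (f := fun i => ‖θ i - ϑ i‖)
    rwa [Nat.card_Ico, Nat.sub_sub_self hk, ← hW₁] at h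
  have hW : η ^ 2 * ‖ϑ (k - ΔT) - θstar‖ ^ 2 ≤ W₁ ^ 2 := by
    rw [← mul_pow]
    exact pow_le_pow_left₀ (by positivity) hW1 2
  have hsum : lam * γ * η ^ 2 / ΔT * V (k - ΔT) ≤
      ∑ i ∈ Finset.Ico (k - ΔT) k, ‖θ i - ϑ i‖ ^ 2 := by
    rw [div_mul_eq_mul_div, div_le_iff₀ hT]
    linarith [mul_le_mul_of_nonneg_left hbig (sq_nonneg η)]
  linarith
end

section
/- Heavy Ball excitation-transfer bound: suppose 0 < β < 2, 0 < γ ≤ β(2−β)/8, the regressor is PE with level ε over window ΔT, ‖φ_k‖ ≤ Φ for all k, η > 0 satisfies γη|1−β| < ε₁ with ε₁ = ε/√(1+Φ²), and k ≥ ΔT. If W₁ ≤ η‖ϑ_{k−ΔT} − θ*‖, then W₂ ≥ (ΔT/(1+γΔT))·(ε₁ − γη|1−β|)·‖ϑ_{k−ΔT} − θ*‖ ≥ 0. -/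
open scoped RealInnerProductSpace

section InnerProduct

variable {E : Type*} [NormedAddCommGroup E] [InnerProductSpace ℝ E]

lemma norm_div_sqrt_one_add_sq_le_one {F : Type*} [SeminormedAddCommGroup F] (x : F) :
    1 / √(1 + ‖x‖ ^ 2) * ‖x‖ ≤ 1 := by
  rw [one_div_mul_eq_div]
  refine div_le_one_of_le₀ (Real.le_sqrt_of_sq_le ?_) (Real.sqrt_nonneg _)
  linarith

/-- The normalized regressor output is at most the norm of its argument. -/
lemma abs_inner_div_sqrt_le_norm (x v : E) :
    1 / √(1 + ‖x‖ ^ 2) * |⟪x, v⟫| ≤ ‖v‖ :=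
  calc 1 / √(1 + ‖x‖ ^ 2) * |⟪x, v⟫|
      ≤ 1 / √(1 + ‖x‖ ^ 2) * (‖x‖ * ‖v‖) := by
        gcongr
        exact abs_real_inner_le_norm x v
    _ = (1 / √(1 + ‖x‖ ^ 2) * ‖x‖) * ‖v‖ := by ring
    _ ≤ 1 * ‖v‖ := by
        gcongr
        exact norm_div_sqrt_one_add_sq_le_one x
    _ = ‖v‖ := one_mul _

lemma abs_inner_add_div_sqrt_le (x u v : E) :
    1 / √(1 + ‖x‖ ^ 2) * |⟪x, u + v⟫| ≤ 1 / √(1 + ‖x‖ ^ 2) * |⟪x, u⟫| + ‖v‖ :=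
  calc 1 / √(1 + ‖x‖ ^ 2) * |⟪x, u + v⟫|
      ≤ 1 / √(1 + ‖x‖ ^ 2) * (|⟪x, u⟫| + |⟪x, v⟫|) := by
        gcongr
        rw [inner_add_right]
        exact abs_add_le _ _
    _ ≤ 1 / √(1 + ‖x‖ ^ 2) * |⟪x, u⟫| + ‖v‖ := by
        rw [mul_add]
        gcongr
        exact abs_inner_div_sqrt_le_norm x v

/-- A normalized gradient step is bounded by the normalized error. -/
lemma norm_normalized_gradient_le {γ : ℝ} (hγ : 0 ≤ γ) (x v : E) :
    ‖(γ / (1 + ‖x‖ ^ 2) * ⟪x, v⟫) • x‖ ≤ γ * (1 / √(1 + ‖x‖ ^ 2) * |⟪x, v⟫|) := by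
  have hN : (0 : ℝ) < 1 + ‖x‖ ^ 2 := by positivity
  have hsq : 1 / (1 + ‖x‖ ^ 2) = 1 / √(1 + ‖x‖ ^ 2) * (1 / √(1 + ‖x‖ ^ 2)) := by
    rw [one_div_mul_one_div, Real.mul_self_sqrt hN.le]
  have heq : ‖(γ / (1 + ‖x‖ ^ 2) * ⟪x, v⟫) • x‖ =
      γ * (1 / √(1 + ‖x‖ ^ 2) * |⟪x, v⟫|) * (1 / √(1 + ‖x‖ ^ 2) * ‖x‖) := by
    rw [norm_smul, Real.norm_eq_abs, abs_mul, abs_of_nonneg (by positivity : 0 ≤ γ / _),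
      div_eq_mul_one_div, hsq]
    ring
  rw [heq]
  exact mul_le_of_le_one_right (by positivity) (norm_div_sqrt_one_add_sq_le_one x)

/-- Homogeneous form of a lower bound on the sum of `|⟪φ i, w⟫|` over unit vectors. -/
lemma mul_norm_le_sum_abs_inner {φ : ℕ → E} {s : Finset ℕ} {c : ℝ}
    (h : ∀ w : E, ‖w‖ = 1 → c ≤ ∑ i ∈ s, |⟪φ i, w⟫|) (v : E) :
    c * ‖v‖ ≤ ∑ i ∈ s, |⟪φ i, v⟫| := by
  rcases eq_or_ne v 0 with rfl | hv
  · simp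
  have hv' : 0 < ‖v‖ := norm_pos_iff.mpr hv
  have h1 := h (‖v‖⁻¹ • v) (by rw [norm_smul, norm_inv, norm_norm, inv_mul_cancel₀ hv'.ne'])
  simp only [inner_smul_right, abs_mul, abs_inv, abs_norm] at h1
  rwa [← Finset.mul_sum, inv_mul_eq_div, le_div_iff₀ hv'] at h1

lemma norm_sub_le_sum_Ico {F : Type*} [SeminormedAddCommGroup F] {u : ℕ → F} {b : ℕ → ℝ}
    (h : ∀ i, ‖u (i + 1) - u i‖ ≤ b i)
    {p k i : ℕ} (hpi : p ≤ i) (hik : i ≤ k) :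
    ‖u p - u i‖ ≤ ∑ j ∈ Finset.Ico p k, b j := by
  rw [← dist_eq_norm]
  refine (dist_le_Ico_sum_of_dist_le hpi fun {j} _ _ => ?_).trans
    (Finset.sum_le_sum_of_subset_of_nonneg (Finset.Ico_subset_Ico_right hik)
      fun j _ _ => (norm_nonneg _).trans (h j))
  rw [dist_comm, dist_eq_norm]
  exact h j

end InnerProduct

theorem hb_excitation_transfer
    (n : ℕ) (hn : 1 ≤ n)
    (θstar : EuclideanSpace ℝ (Fin n))
    (φ θ ϑ : ℕ → EuclideanSpace ℝ (Fin n))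
    (β γ : ℝ) (hβ0 : 0 < β) (hβ2 : β < 2)
    (hγ0 : 0 < γ) (hγ : γ ≤ β * (2 - β) / 8)
    (hθ : ∀ k, θ (k + 1) = θ k - β • (θ k - ϑ k))
    (hϑ : ∀ k, ϑ (k + 1) =
      ϑ k - ((γ / (1 + ‖φ k‖ ^ 2)) * ⟪φ k, θ (k + 1) - θstar⟫) • φ k)
    (ΔT : ℕ) (hΔT : 1 ≤ ΔT) (k : ℕ) (hk : ΔT ≤ k)
    (W₁ W₂ : ℝ)
    (hW₁ : W₁ = ∑ i ∈ Finset.Ico (k - ΔT) k, ‖θ i - ϑ i‖)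
    (hW₂ : W₂ = ∑ i ∈ Finset.Ico (k - ΔT) k,
      (1 / Real.sqrt (1 + ‖φ i‖ ^ 2)) * |⟪φ i, ϑ i - θstar⟫|)
    (ε : ℝ) (hε : 0 < ε)
    (hPE : ∀ m, ΔT ≤ m → ∀ w : EuclideanSpace ℝ (Fin n), ‖w‖ = 1 →
      ε ≤ (1 / (ΔT : ℝ)) * ∑ i ∈ Finset.Ico (m - ΔT) m, |⟪φ i, w⟫|)
    (Φ : ℝ) (hΦ : ∀ m, ‖φ m‖ ≤ Φ)
    (η : ℝ) (hη : 0 < η)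
    (hηε : γ * η * |1 - β| < ε / Real.sqrt (1 + Φ ^ 2))
    (hW1 : W₁ ≤ η * ‖ϑ (k - ΔT) - θstar‖) :
    ((ΔT : ℝ) / (1 + γ * ΔT)) * (ε / Real.sqrt (1 + Φ ^ 2) - γ * η * |1 - β|) *
        ‖ϑ (k - ΔT) - θstar‖ ≤ W₂ ∧
    0 ≤ ((ΔT : ℝ) / (1 + γ * ΔT)) * (ε / Real.sqrt (1 + Φ ^ 2) - γ * η * |1 - β|) *
        ‖ϑ (k - ΔT) - θstar‖ := by
  have hT : (0 : ℝ) < ΔT := by exact_mod_cast hΔT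
  have hNΦ : 0 < √(1 + Φ ^ 2) := by positivity
  refine ⟨?_, mul_nonneg (mul_nonneg (by positivity) (by linarith)) (norm_nonneg _)⟩
  set p := k - ΔT with hp
  set s := Finset.Ico p k with hs
  have hcard : (s.card : ℝ) = ΔT := by
    rw [hs, Nat.card_Ico, hp, Nat.sub_sub_self hk]
  set a : ℕ → ℝ := fun i => 1 / √(1 + ‖φ i‖ ^ 2) * |⟪φ i, ϑ i - θstar⟫| with ha
  have hstep (i : ℕ) : ‖ϑ (i + 1) - ϑ i‖ ≤ γ * (a i + |1 - β| * ‖θ i - ϑ i‖) := by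
    have herr : θ (i + 1) - θstar = (ϑ i - θstar) + (1 - β) • (θ i - ϑ i) := by
      rw [hθ]
      module
    have h1 := norm_normalized_gradient_le hγ0.le (φ i) (θ (i + 1) - θstar)
    have h2 := abs_inner_add_div_sqrt_le (φ i) (ϑ i - θstar) ((1 - β) • (θ i - ϑ i))
    rw [← herr, norm_smul, Real.norm_eq_abs] at h2
    rw [hϑ, sub_sub_cancel_left, norm_neg]
    exact h1.trans (mul_le_mul_of_nonneg_left h2 hγ0.le)
  have hdrift : ∑ j ∈ s, γ * (a j + |1 - β| * ‖θ j - ϑ j‖) = γ * (W₂ + |1 - β| * W₁) := by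
    rw [← Finset.mul_sum, Finset.sum_add_distrib, ← Finset.mul_sum, ← hW₁, ← hW₂]
  have hterm : ∀ i ∈ s, 1 / √(1 + Φ ^ 2) * |⟪φ i, ϑ p - θstar⟫| ≤
      a i + γ * (W₂ + |1 - β| * W₁) := by
    intro i hi
    obtain ⟨hpi, hik⟩ := Finset.mem_Ico.mp hi
    have h1 := abs_inner_add_div_sqrt_le (φ i) (ϑ i - θstar) (ϑ p - ϑ i)
    rw [show ϑ i - θstar + (ϑ p - ϑ i) = ϑ p - θstar by abel] at h1
    have h2 := norm_sub_le_sum_Ico hstep hpi hik.le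
    rw [← hs, hdrift] at h2
    have h3 : 1 / √(1 + Φ ^ 2) * |⟪φ i, ϑ p - θstar⟫| ≤
        1 / √(1 + ‖φ i‖ ^ 2) * |⟪φ i, ϑ p - θstar⟫| := by
      gcongr
      exact hΦ i
    linarith
  have hsum := Finset.sum_le_sum hterm
  rw [← Finset.mul_sum, Finset.sum_add_distrib, ← hW₂, Finset.sum_const, nsmul_eq_mul,
    hcard] at hsum
  have hexc : ΔT * ε * ‖ϑ p - θstar‖ ≤ ∑ i ∈ s, |⟪φ i, ϑ p - θstar⟫| := by
    refine mul_norm_le_sum_abs_inner (fun w hw => ?_) _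
    have h1 := hPE k hk w hw
    rwa [one_div_mul_eq_div, le_div_iff₀ hT, mul_comm] at h1
  have hexc' : ΔT * (ε / √(1 + Φ ^ 2)) * ‖ϑ p - θstar‖ ≤
      1 / √(1 + Φ ^ 2) * ∑ i ∈ s, |⟪φ i, ϑ p - θstar⟫| :=
    calc ΔT * (ε / √(1 + Φ ^ 2)) * ‖ϑ p - θstar‖
        = 1 / √(1 + Φ ^ 2) * (ΔT * ε * ‖ϑ p - θstar‖) := by ring
      _ ≤ _ := by gcongr
  have hW : ΔT * (γ * |1 - β|) * W₁ ≤ ΔT * (γ * |1 - β|) * (η * ‖ϑ p - θstar‖) := by gcongr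
  rw [div_mul_eq_mul_div, div_mul_eq_mul_div, div_le_iff₀ (by positivity)]
  linarith
end

section
/- Heavy Ball Case 1(b) contraction: suppose 0 < β < 2, 0 < γ ≤ β(2−β)/8, the regressor is PE with level ε over window ΔT, ‖φ_k‖ ≤ Φ for all k, 0 < λ < 1, η > 0 satisfies γη|1−β| < ε₁ with ε₁ = ε/√(1+Φ²), and k ≥ ΔT. If ‖ϑ_{k−ΔT} − θ*‖² ≥ λγ V_{k−ΔT} and W₁ ≤ η‖ϑ_{k−ΔT} − θ*‖, then V_k ≤ [1 − (21/32)·(ΔT/(1+γΔT)²)·(ε₁ − γη|1−β|)²·λγ]·V_{k−ΔT}. -/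
open scoped RealInnerProductSpace

/-- One step of the heavy ball error recursion decreases the sum of squares by at least
`(21 / 32) * γ` times the squared normalized output error. -/
lemma heavyBall_step_decrease {E : Type*} [NormedAddCommGroup E] [InnerProductSpace ℝ E]
    {a x d : E} {β γ : ℝ} (ha : ‖a‖ ≤ 1) (hγ0 : 0 < γ) (hγ : γ ≤ β * (2 - β) / 8) :
    ‖x - (γ * (⟪a, x⟫ + (1 - β) * ⟪a, d⟫)) • a‖ ^ 2
      + ‖(1 - β) • d + (γ * (⟪a, x⟫ + (1 - β) * ⟪a, d⟫)) • a‖ ^ 2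
      ≤ ‖x‖ ^ 2 + ‖d‖ ^ 2 - 21 / 32 * γ * ⟪a, x⟫ ^ 2 := by
  have hq : ⟪a, d⟫ ^ 2 ≤ ‖d‖ ^ 2 := by
    rw [← sq_abs]
    have : |⟪a, d⟫| ≤ ‖d‖ :=
      (abs_real_inner_le_norm a d).trans (mul_le_of_le_one_left (norm_nonneg d) ha)
    gcongr
  have ha2 : ‖a‖ ^ 2 ≤ 1 := pow_le_one₀ (norm_nonneg a) ha
  rw [norm_sub_sq_real, norm_add_sq_real]
  simp only [norm_smul, mul_pow, Real.norm_eq_abs, sq_abs, inner_smul_left, inner_smul_right,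
    RCLike.conj_to_real, real_inner_comm a x, real_inner_comm a d]
  set p := ⟪a, x⟫
  set q := ⟪a, d⟫
  set b := 1 - β with hb
  have hβγ : b ^ 2 ≤ 1 - 8 * γ := by rw [hb]; linarith
  have hγ8 : γ ≤ 1 / 8 := by nlinarith [sq_nonneg b]
  have hd : b ^ 2 * ‖d‖ ^ 2 ≤ (1 - 8 * γ) * ‖d‖ ^ 2 := by gcongr
  have hnoise : γ ^ 2 * (p + b * q) ^ 2 * ‖a‖ ^ 2 ≤ γ * (1 / 8) * (p + b * q) ^ 2 := by
    have : γ * ‖a‖ ^ 2 ≤ 1 / 8 * 1 := by gcongr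
    calc _ = γ * (p + b * q) ^ 2 * (γ * ‖a‖ ^ 2) := by ring
      _ ≤ γ * (p + b * q) ^ 2 * (1 / 8 * 1) := by gcongr
      _ = _ := by ring
  have hbq : (b * q) ^ 2 ≤ ‖d‖ ^ 2 := by
    rw [mul_pow]
    exact (mul_le_of_le_one_left (sq_nonneg q) (by linarith)).trans hq
  have hquad : γ * (-2 * p ^ 2 + 2 * (b * q) ^ 2 + 1 / 4 * (p + b * q) ^ 2 - 8 * ‖d‖ ^ 2)
      ≤ γ * (-(21 / 32) * p ^ 2) := by
    gcongr
    nlinarith [sq_nonneg (p - b * q), sq_nonneg p, sq_nonneg (b * q)]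
  linarith

/-- The displacement over a window of the error recursion is at most the path length, which the
normalized output errors and the norms of `d` control. -/
lemma heavyBall_norm_sub_le {E : Type*} [NormedAddCommGroup E] [InnerProductSpace ℝ E]
    {a x d : ℕ → E} {b γ : ℝ} (ha : ∀ i, ‖a i‖ ≤ 1) (hγ : 0 ≤ γ)
    (hx : ∀ i, x (i + 1) = x i - (γ * (⟪a i, x i⟫ + b * ⟪a i, d i⟫)) • a i) (j : ℕ) :
    ‖x j - x 0‖ ≤ γ * ∑ i ∈ Finset.range j, (|⟪a i, x i⟫| + |b| * ‖d i‖) := by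
  induction j with
  | zero => simp
  | succ j ih =>
    rw [Finset.sum_range_succ, mul_add]
    have hstep : ‖x (j + 1) - x j‖ ≤ γ * (|⟪a j, x j⟫| + |b| * ‖d j‖) := by
      have hq : |⟪a j, d j⟫| ≤ ‖d j‖ := (abs_real_inner_le_norm _ _).trans
        (mul_le_of_le_one_left (norm_nonneg _) (ha j))
      rw [hx, sub_sub_cancel_left, norm_neg, norm_smul, Real.norm_eq_abs, abs_mul,
        abs_of_nonneg hγ]
      calc _ ≤ γ * |⟪a j, x j⟫ + b * ⟪a j, d j⟫| :=
            mul_le_of_le_one_right (by positivity) (ha j)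
        _ ≤ γ * (|⟪a j, x j⟫| + |b * ⟪a j, d j⟫|) := by gcongr; exact abs_add_le _ _
        _ ≤ _ := by rw [abs_mul]; gcongr
    calc ‖x (j + 1) - x 0‖ = ‖(x j - x 0) + (x (j + 1) - x j)‖ := by congr 1; abel
      _ ≤ _ := (norm_add_le _ _).trans (add_le_add ih hstep)

/-- The normalized output errors along the trajectory dominate, up to drift, those of the initial
error. -/
lemma heavyBall_sum_abs_inner_le {E : Type*} [NormedAddCommGroup E] [InnerProductSpace ℝ E]
    {a x d : ℕ → E} {b γ : ℝ} (ha : ∀ i, ‖a i‖ ≤ 1) (hγ : 0 ≤ γ)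
    (hx : ∀ i, x (i + 1) = x i - (γ * (⟪a i, x i⟫ + b * ⟪a i, d i⟫)) • a i) (T : ℕ) :
    ∑ i ∈ Finset.range T, |⟪a i, x 0⟫| ≤ (1 + γ * T) * ∑ i ∈ Finset.range T, |⟪a i, x i⟫|
      + γ * T * |b| * ∑ i ∈ Finset.range T, ‖d i‖ := by
  have hterm : ∀ i ∈ Finset.range T, |⟪a i, x 0⟫| ≤ |⟪a i, x i⟫|
      + γ * ∑ i ∈ Finset.range T, (|⟪a i, x i⟫| + |b| * ‖d i‖) := by
    intro i hi
    have hmono : ∑ j ∈ Finset.range i, (|⟪a j, x j⟫| + |b| * ‖d j‖)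
        ≤ ∑ j ∈ Finset.range T, (|⟪a j, x j⟫| + |b| * ‖d j‖) :=
      Finset.sum_le_sum_of_subset_of_nonneg
        (Finset.range_subset_range.2 (Finset.mem_range.1 hi).le) fun _ _ _ => by positivity
    have hdrift : |⟪a i, x i - x 0⟫| ≤ ‖x i - x 0‖ := (abs_real_inner_le_norm _ _).trans
      (mul_le_of_le_one_left (norm_nonneg _) (ha i))
    calc |⟪a i, x 0⟫| = |⟪a i, x i⟫ - ⟪a i, x i - x 0⟫| := by rw [inner_sub_right]; ring_nf
      _ ≤ |⟪a i, x i⟫| + |⟪a i, x i - x 0⟫| := abs_sub _ _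
      _ ≤ _ := by
        gcongr
        exact hdrift.trans <| (heavyBall_norm_sub_le ha hγ hx i).trans (by gcongr)
  refine (Finset.sum_le_sum hterm).trans_eq ?_
  simp only [Finset.sum_add_distrib, Finset.sum_const, Finset.card_range, nsmul_eq_mul,
    ← Finset.mul_sum]
  ring

/-- Contraction over a window, in error coordinates with a normalized regressor `a`. -/
lemma heavyBall_window_decrease {E : Type*} [NormedAddCommGroup E] [InnerProductSpace ℝ E]
    {a x d : ℕ → E} {β γ ε η : ℝ} {T : ℕ} (hT : 1 ≤ T) (ha : ∀ i, ‖a i‖ ≤ 1)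
    (hγ0 : 0 < γ) (hγ : γ ≤ β * (2 - β) / 8)
    (hx : ∀ i, x (i + 1) = x i - (γ * (⟪a i, x i⟫ + (1 - β) * ⟪a i, d i⟫)) • a i)
    (hd : ∀ i, d (i + 1) = (1 - β) • d i + (γ * (⟪a i, x i⟫ + (1 - β) * ⟪a i, d i⟫)) • a i)
    (hε : γ * η * |1 - β| ≤ ε)
    (hPE : T * ε * ‖x 0‖ ≤ ∑ i ∈ Finset.range T, |⟪a i, x 0⟫|)
    (hη : ∑ i ∈ Finset.range T, ‖d i‖ ≤ η * ‖x 0‖) :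
    ‖x T‖ ^ 2 + ‖d T‖ ^ 2 ≤ ‖x 0‖ ^ 2 + ‖d 0‖ ^ 2
      - 21 / 32 * γ * (T / (1 + γ * T) ^ 2 * (ε - γ * η * |1 - β|) ^ 2 * ‖x 0‖ ^ 2) := by
  have hT0 : (0 : ℝ) < T := by exact_mod_cast hT
  set W := ∑ i ∈ Finset.range T, |⟪a i, x i⟫|
  have hsum : ∀ j, ‖x j‖ ^ 2 + ‖d j‖ ^ 2 ≤ ‖x 0‖ ^ 2 + ‖d 0‖ ^ 2
      - 21 / 32 * γ * ∑ i ∈ Finset.range j, ⟪a i, x i⟫ ^ 2 := by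
    intro j
    induction j with
    | zero => simp
    | succ j ih =>
      have := heavyBall_step_decrease (x := x j) (d := d j) (ha j) hγ0 hγ
      rw [← hx, ← hd] at this
      rw [Finset.sum_range_succ]
      linarith
  have hCS : W ^ 2 ≤ T * ∑ i ∈ Finset.range T, ⟪a i, x i⟫ ^ 2 := by
    simpa [sq_abs] using
      sq_sum_le_card_mul_sum_sq (s := Finset.range T) (f := fun i => |⟪a i, x i⟫|)
  have hlow : T * (ε - γ * η * |1 - β|) * ‖x 0‖ ≤ (1 + γ * T) * W := by
    have hdrift : γ * T * |1 - β| * ∑ i ∈ Finset.range T, ‖d i‖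
        ≤ γ * T * |1 - β| * (η * ‖x 0‖) := by gcongr
    have := heavyBall_sum_abs_inner_le ha hγ0.le hx T
    linarith
  have hsq : (T * (ε - γ * η * |1 - β|) * ‖x 0‖) ^ 2 ≤ ((1 + γ * T) * W) ^ 2 := by
    have := sub_nonneg.2 hε
    gcongr
  have hmain : T / (1 + γ * T) ^ 2 * (ε - γ * η * |1 - β|) ^ 2 * ‖x 0‖ ^ 2
      ≤ ∑ i ∈ Finset.range T, ⟪a i, x i⟫ ^ 2 := by
    have hpos : 0 < T * (1 + γ * T) ^ 2 := by positivity
    refine le_of_mul_le_mul_left ?_ hpos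
    calc _ = (T * (ε - γ * η * |1 - β|) * ‖x 0‖) ^ 2 := by field_simp
      _ ≤ (1 + γ * T) ^ 2 * W ^ 2 := by rwa [← mul_pow]
      _ ≤ (1 + γ * T) ^ 2 * (T * ∑ i ∈ Finset.range T, ⟪a i, x i⟫ ^ 2) := by gcongr
      _ = _ := by ring
  refine (hsum T).trans ?_
  gcongr

theorem hb_case1b
    (n : ℕ) (hn : 1 ≤ n)
    (θstar : EuclideanSpace ℝ (Fin n))
    (φ θ ϑ : ℕ → EuclideanSpace ℝ (Fin n))
    (β γ : ℝ) (hβ0 : 0 < β) (hβ2 : β < 2)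
    (hγ0 : 0 < γ) (hγ : γ ≤ β * (2 - β) / 8)
    (hθ : ∀ k, θ (k + 1) = θ k - β • (θ k - ϑ k))
    (hϑ : ∀ k, ϑ (k + 1) =
      ϑ k - ((γ / (1 + ‖φ k‖ ^ 2)) * ⟪φ k, θ (k + 1) - θstar⟫) • φ k)
    (V : ℕ → ℝ)
    (hV : ∀ k, V k = (1 / γ) * ‖ϑ k - θstar‖ ^ 2 + (1 / γ) * ‖θ k - ϑ k‖ ^ 2)
    (ΔT : ℕ) (hΔT : 1 ≤ ΔT) (k : ℕ) (hk : ΔT ≤ k)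
    (W₁ W₂ : ℝ)
    (hW₁ : W₁ = ∑ i ∈ Finset.Ico (k - ΔT) k, ‖θ i - ϑ i‖)
    (hW₂ : W₂ = ∑ i ∈ Finset.Ico (k - ΔT) k,
      (1 / Real.sqrt (1 + ‖φ i‖ ^ 2)) * |⟪φ i, ϑ i - θstar⟫|)
    (ε : ℝ) (hε : 0 < ε)
    (hPE : ∀ m, ΔT ≤ m → ∀ w : EuclideanSpace ℝ (Fin n), ‖w‖ = 1 →
      ε ≤ (1 / (ΔT : ℝ)) * ∑ i ∈ Finset.Ico (m - ΔT) m, |⟪φ i, w⟫|)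
    (Φ : ℝ) (hΦ : ∀ m, ‖φ m‖ ≤ Φ)
    (lam η : ℝ) (hlam0 : 0 < lam) (hlam1 : lam < 1) (hη : 0 < η)
    (hηε : γ * η * |1 - β| < ε / Real.sqrt (1 + Φ ^ 2))
    (hbig : lam * γ * V (k - ΔT) ≤ ‖ϑ (k - ΔT) - θstar‖ ^ 2)
    (hW1 : W₁ ≤ η * ‖ϑ (k - ΔT) - θstar‖) :
    V k ≤ (1 - (21 / 32) * ((ΔT : ℝ) / (1 + γ * ΔT) ^ 2) *
      (ε / Real.sqrt (1 + Φ ^ 2) - γ * η * |1 - β|) ^ 2 * lam * γ) * V (k - ΔT) := by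
  obtain ⟨s, rfl⟩ : ∃ s, k = s + ΔT := ⟨k - ΔT, by omega⟩
  have hPEs := hPE (s + ΔT) hk
  simp only [Nat.add_sub_cancel, Finset.sum_Ico_eq_sum_range, Nat.add_sub_cancel_left]
    at hW₁ hbig hW1 hPEs ⊢
  subst hW₁
  have hT0 : (0 : ℝ) < ΔT := by exact_mod_cast hΔT
  set r : ℕ → ℝ := fun i => (√(1 + ‖φ (s + i)‖ ^ 2))⁻¹ with hr
  have hr0 : ∀ i, 0 < r i := fun i => by positivity
  have hr2 : ∀ i, r i * r i = (1 + ‖φ (s + i)‖ ^ 2)⁻¹ := fun i => by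
    rw [hr, ← mul_inv, Real.mul_self_sqrt (by positivity)]
  set a : ℕ → EuclideanSpace ℝ (Fin n) := fun i => r i • φ (s + i) with haDef
  set x : ℕ → EuclideanSpace ℝ (Fin n) := fun i => ϑ (s + i) - θstar with hxDef
  set d : ℕ → EuclideanSpace ℝ (Fin n) := fun i => θ (s + i) - ϑ (s + i) with hdDef
  have ha : ∀ i, ‖a i‖ ≤ 1 := by
    intro i
    rw [haDef, norm_smul, Real.norm_of_nonneg (hr0 i).le, inv_mul_le_one₀ (by positivity)]
    exact Real.le_sqrt_of_sq_le (by linarith)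
  have hθx : ∀ i, θ (s + i + 1) - θstar = x i + (1 - β) • d i := by
    intro i
    rw [hθ, hxDef, hdDef]
    module
  have hgain : ∀ i, ((γ / (1 + ‖φ (s + i)‖ ^ 2)) * ⟪φ (s + i), θ (s + i + 1) - θstar⟫)
      • φ (s + i) = (γ * (⟪a i, x i⟫ + (1 - β) * ⟪a i, d i⟫)) • a i := by
    intro i
    rw [hθx, inner_add_right, inner_smul_right, haDef, smul_smul, real_inner_smul_left,
      real_inner_smul_left, div_eq_mul_inv, ← hr2]
    congr 1
    ring
  have hx : ∀ i, x (i + 1) = x i - (γ * (⟪a i, x i⟫ + (1 - β) * ⟪a i, d i⟫)) • a i := by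
    intro i
    rw [← hgain]
    simp only [hxDef, ← add_assoc]
    rw [hϑ]
    abel
  have hd : ∀ i, d (i + 1) =
      (1 - β) • d i + (γ * (⟪a i, x i⟫ + (1 - β) * ⟪a i, d i⟫)) • a i := by
    intro i
    have h₁ : d (i + 1) = (θ (s + i + 1) - θstar) - x (i + 1) := by
      simp only [hxDef, hdDef, ← add_assoc]
      abel
    rw [h₁, hθx, hx]
    abel
  have hpe : ΔT * (ε / √(1 + Φ ^ 2)) * ‖x 0‖ ≤ ∑ i ∈ Finset.range ΔT, |⟪a i, x 0⟫| := by
    rcases eq_or_ne (x 0) 0 with h0 | h0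
    · simp [h0]
    have hpos : 0 < ‖x 0‖ := norm_pos_iff.2 h0
    have h := hPEs (‖x 0‖⁻¹ • x 0) (norm_smul_inv_norm h0)
    simp only [inner_smul_right, abs_mul, abs_inv, abs_norm, ← Finset.mul_sum] at h
    have hraw : ΔT * ε * ‖x 0‖ ≤ ∑ i ∈ Finset.range ΔT, |⟪φ (s + i), x 0⟫| := by
      field_simp at h
      linarith
    have hinv : ∀ i, (√(1 + Φ ^ 2))⁻¹ ≤ r i := by
      intro i
      have := hΦ (s + i)
      simp only [hr]
      gcongr
    calc _ = (√(1 + Φ ^ 2))⁻¹ * (ΔT * ε * ‖x 0‖) := by ring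
      _ ≤ (√(1 + Φ ^ 2))⁻¹ * ∑ i ∈ Finset.range ΔT, |⟪φ (s + i), x 0⟫| := by gcongr
      _ = ∑ i ∈ Finset.range ΔT, (√(1 + Φ ^ 2))⁻¹ * |⟪φ (s + i), x 0⟫| := Finset.mul_sum ..
      _ ≤ _ := by
        refine Finset.sum_le_sum fun i _ => ?_
        rw [haDef, real_inner_smul_left, abs_mul, abs_of_pos (hr0 i)]
        exact mul_le_mul_of_nonneg_right (hinv i) (abs_nonneg _)
  have hdec := heavyBall_window_decrease hΔT ha hγ0 hγ hx hd hηε.le hpe hW1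
  have hV0 : γ * V s = ‖x 0‖ ^ 2 + ‖d 0‖ ^ 2 := by
    rw [hV]
    simp only [hxDef, hdDef, add_zero]
    field_simp
  have hVT : γ * V (s + ΔT) = ‖x ΔT‖ ^ 2 + ‖d ΔT‖ ^ 2 := by
    rw [hV]
    field_simp
    rfl
  rw [← hV0, ← hVT] at hdec
  set c := (ΔT : ℝ) / (1 + γ * ΔT) ^ 2 * (ε / √(1 + Φ ^ 2) - γ * η * |1 - β|) ^ 2 with hc
  have hcV : 21 / 32 * γ * (c * (lam * γ * V s)) ≤ 21 / 32 * γ * (c * ‖x 0‖ ^ 2) := by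
    have hc0 : 0 ≤ c := by positivity
    have : lam * γ * V s ≤ ‖x 0‖ ^ 2 := hbig
    gcongr
  refine le_of_mul_le_mul_left ?_ hγ0
  rw [mul_assoc (21 / 32 : ℝ), ← hc]
  linarith
end

section
/- Heavy Ball Case 2 contraction: suppose 0 < β < 2, 0 < γ ≤ β(2−β)/8, 0 < λ < 1, and k ≥ ΔT. If ‖ϑ_{k−ΔT} − θ*‖² ≤ λγ V_{k−ΔT}, then ‖θ_{k−ΔT} − ϑ_{k−ΔT}‖² ≥ (1−λ)γ V_{k−ΔT} and V_k ≤ [1 − (11/8)(1−λ)γ/ΔT]·V_{k−ΔT}. -/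
open scoped RealInnerProductSpace

/-- One step of the Heavy Ball recursion, in the error variables `x = ϑ - θ*` and `y = θ - ϑ`:
the Lyapunov function decreases by at least `4 ‖y‖²`. -/
theorem heavyBall_step_le {E : Type*} [NormedAddCommGroup E] [InnerProductSpace ℝ E]
    (x y p : E) {β γ : ℝ} (hγ0 : 0 < γ) (hγ : γ ≤ β * (2 - β) / 8) :
    let u := ((γ / (1 + ‖p‖ ^ 2)) * ⟪p, x + (1 - β) • y⟫) • p
    ‖x - u‖ ^ 2 + ‖(1 - β) • y + u‖ ^ 2 ≤ ‖x‖ ^ 2 + ‖y‖ ^ 2 - 4 * γ * ‖y‖ ^ 2 := by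
  intro u
  have hN : 0 < 1 + ‖p‖ ^ 2 := by positivity
  have hinner : ⟪x, u⟫ + (1 - β) * ⟪y, u⟫ =
      γ / (1 + ‖p‖ ^ 2) * ⟪p, x + (1 - β) • y⟫ ^ 2 := by
    have h : ⟪x + (1 - β) • y, u⟫ = γ / (1 + ‖p‖ ^ 2) * ⟪p, x + (1 - β) • y⟫ ^ 2 := by
      simp only [u, real_inner_smul_right, real_inner_comm p]
      ring
    rwa [inner_add_left, real_inner_smul_left] at h
  have hu : ‖u‖ ^ 2 ≤ γ * (⟪x, u⟫ + (1 - β) * ⟪y, u⟫) := by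
    rw [hinner]
    have h : ‖u‖ ^ 2 = γ * (γ / (1 + ‖p‖ ^ 2) * ⟪p, x + (1 - β) • y⟫ ^ 2) *
        (‖p‖ ^ 2 / (1 + ‖p‖ ^ 2)) := by
      simp only [u, norm_smul, mul_pow, Real.norm_eq_abs, sq_abs]
      ring
    rw [h]
    refine mul_le_of_le_one_right (by positivity) ?_
    rw [div_le_one hN]
    linarith
  clear_value u
  have hsq : 0 ≤ ‖u‖ ^ 2 - 4 * γ * (1 - β) * ⟪y, u⟫ + 4 * γ ^ 2 * (1 - β) ^ 2 * ‖y‖ ^ 2 := by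
    have h := sq_nonneg ‖u - (2 * γ * (1 - β)) • y‖
    rw [norm_sub_sq_real, real_inner_smul_right, real_inner_comm, norm_smul, mul_pow,
      Real.norm_eq_abs, sq_abs] at h
    linarith
  have hγ8 : γ ≤ 1 / 8 := by nlinarith [sq_nonneg (1 - β)]
  have hβ1 : (1 - β) ^ 2 ≤ 1 - 8 * γ := by nlinarith
  rw [norm_sub_sq_real, norm_add_sq_real, real_inner_smul_left, norm_smul, mul_pow,
    Real.norm_eq_abs, sq_abs]
  have hy := sq_nonneg ‖y‖
  have hyβ := mul_le_mul_of_nonneg_right hβ1 hy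
  have hγy : 0 ≤ γ ^ 2 * ‖y‖ ^ 2 := by positivity
  refine le_of_mul_le_mul_left ?_ hγ0
  nlinarith [sq_nonneg ‖u‖]

theorem hb_case2
    (n : ℕ) (hn : 1 ≤ n)
    (θstar : EuclideanSpace ℝ (Fin n))
    (φ θ ϑ : ℕ → EuclideanSpace ℝ (Fin n))
    (β γ : ℝ) (hβ0 : 0 < β) (hβ2 : β < 2)
    (hγ0 : 0 < γ) (hγ : γ ≤ β * (2 - β) / 8)
    (hθ : ∀ k, θ (k + 1) = θ k - β • (θ k - ϑ k))
    (hϑ : ∀ k, ϑ (k + 1) =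
      ϑ k - ((γ / (1 + ‖φ k‖ ^ 2)) * ⟪φ k, θ (k + 1) - θstar⟫) • φ k)
    (V : ℕ → ℝ)
    (hV : ∀ k, V k = (1 / γ) * ‖ϑ k - θstar‖ ^ 2 + (1 / γ) * ‖θ k - ϑ k‖ ^ 2)
    (ΔT : ℕ) (hΔT : 1 ≤ ΔT) (k : ℕ) (hk : ΔT ≤ k)
    (lam : ℝ) (hlam0 : 0 < lam) (hlam1 : lam < 1)
    (hsmall : ‖ϑ (k - ΔT) - θstar‖ ^ 2 ≤ lam * γ * V (k - ΔT)) :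
    (1 - lam) * γ * V (k - ΔT) ≤ ‖θ (k - ΔT) - ϑ (k - ΔT)‖ ^ 2 ∧
    V k ≤ (1 - (11 / 8) * (1 - lam) * γ / (ΔT : ℝ)) * V (k - ΔT) := by
  have hstep : ∀ j, V (j + 1) ≤ V j - 4 * ‖θ j - ϑ j‖ ^ 2 := by
    intro j
    have h := heavyBall_step_le (ϑ j - θstar) (θ j - ϑ j) (φ j) hγ0 hγ
    have hθ' : ϑ j - θstar + (1 - β) • (θ j - ϑ j) = θ (j + 1) - θstar := by
      rw [hθ]
      module
    simp only [hθ'] at h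
    have hx : ϑ (j + 1) - θstar = ϑ j - θstar -
        ((γ / (1 + ‖φ j‖ ^ 2)) * ⟪φ j, θ (j + 1) - θstar⟫) • φ j := by
      rw [hϑ]
      abel
    have hy : θ (j + 1) - ϑ (j + 1) = (1 - β) • (θ j - ϑ j) +
        ((γ / (1 + ‖φ j‖ ^ 2)) * ⟪φ j, θ (j + 1) - θstar⟫) • φ j := by
      rw [hϑ, ← sub_add, add_left_inj, hθ]
      module
    rw [← hx, ← hy] at h
    rw [hV, hV, ← mul_add, ← mul_add, ← sub_nonneg]
    have hdiv := mul_le_mul_of_nonneg_left h (one_div_pos.mpr hγ0).le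
    have hcancel : 1 / γ * (4 * γ * ‖θ j - ϑ j‖ ^ 2) = 4 * ‖θ j - ϑ j‖ ^ 2 := by
      field_simp
    rw [mul_sub, hcancel] at hdiv
    linarith
  have hanti : Antitone V :=
    antitone_nat_of_succ_le fun j => (hstep j).trans (by linarith [sq_nonneg ‖θ j - ϑ j‖])
  set m := k - ΔT with hm
  have hlarge : (1 - lam) * γ * V m ≤ ‖θ m - ϑ m‖ ^ 2 := by
    have h : γ * V m = ‖ϑ m - θstar‖ ^ 2 + ‖θ m - ϑ m‖ ^ 2 := by
      rw [hV]
      field_simp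
    linarith
  refine ⟨hlarge, ?_⟩
  have hVm : 0 ≤ V m := by
    rw [hV]
    positivity
  have hpos : 0 ≤ (1 - lam) * γ * V m :=
    mul_nonneg (mul_nonneg (sub_nonneg.mpr hlam1.le) hγ0.le) hVm
  have hk' : V k ≤ V (m + 1) := hanti (by omega)
  have hdiv : (1 - lam) * γ * V m / (ΔT : ℝ) ≤ (1 - lam) * γ * V m :=
    div_le_self hpos (by exact_mod_cast hΔT)
  calc V k ≤ V m - (11 / 8) * ((1 - lam) * γ * V m / (ΔT : ℝ)) := by
        linarith [hstep m]
    _ = (1 - (11 / 8) * (1 - lam) * γ / (ΔT : ℝ)) * V m := by ring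
end

section
/- Lyapunov decrement for the Nesterov-acceleration high-order tuner: if 0 < β < 1 and 0 < γ ≤ β(2−β)/(8+β²), then for every k ≥ 0, V_{k+1} − V_k ≤ −(7/4)‖θ̄_k − ϑ_k‖² − (9/16)(1/𝒩_k)⟨φ_k, ϑ_k − θ*⟩². In particular V_{k+1} ≤ V_k for all k. -/
open scoped RealInnerProductSpace

/-- The scalar inequality behind the decrement: `p`, `q` stand for the inner products of the regressor
with `ϑ - θ*` and `θ̄ - ϑ`, `a` for that with `θ - θ*`, and `s` for the squared norm of the
normalized regressor. -/
theorem na_cross_terms_le {β γ p q a s : ℝ} (hβ0 : 0 < β) (hβ1 : β < 1) (hγ0 : 0 < γ)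
    (hγ : γ ≤ 1 / 8) (hγβ : γ * β ≤ 1 / 9) (hs0 : 0 ≤ s) (hs1 : s ≤ 1)
    (ha : a * (1 - γ * β * s) = p + q) :
    -2 * (p + (1 - β) * q) * p + 2 * γ * s * (p + (1 - β) * q) ^ 2
      + 2 * (1 - β) * (p + (1 - β) * q) * q - 2 * β * a * q - γ * β ^ 2 * a ^ 2 * s
      ≤ -(9 / 16) * p ^ 2 + 3 * q ^ 2 := by
  have ht : γ * β * s ≤ 1 / 9 := by nlinarith [mul_pos hγ0 hβ0]
  have hr : (1 - β) ^ 2 * q ^ 2 ≤ q ^ 2 :=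
    mul_le_of_le_one_left (sq_nonneg q) (by nlinarith)
  have haq : -(9 / 32) * p ^ 2 ≤ a * q := by
    have h : (a * q) * (1 - γ * β * s) = (p + q) * q := by rw [← ha]; ring
    by_cases h0 : 0 ≤ a * q
    · nlinarith [sq_nonneg p]
    · nlinarith [sq_nonneg (p + 2 * q)]
  have hβaq : -(9 / 32) * p ^ 2 ≤ β * (a * q) := by
    nlinarith [mul_le_mul_of_nonneg_left haq hβ0.le, sq_nonneg p]
  have he : 2 * γ * s * (p + (1 - β) * q) ^ 2 ≤ 1 / 2 * (p ^ 2 + q ^ 2) := by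
    have hγs : 2 * γ * s ≤ 1 / 4 := by nlinarith
    have h := mul_le_mul_of_nonneg_right hγs (sq_nonneg (p + (1 - β) * q))
    nlinarith [sq_nonneg (p - (1 - β) * q)]
  have hd : 0 ≤ γ * β ^ 2 * a ^ 2 * s := by positivity
  nlinarith [sq_nonneg p, sq_nonneg q]

/-- The one-step decrement in terms of `u = ϑ - θ*` and `d = θ̄ - ϑ`. -/
theorem na_decrement_step {E : Type*} [NormedAddCommGroup E] [InnerProductSpace ℝ E]
    (f u d : E) {β γ a : ℝ} (hβ0 : 0 < β) (hβ1 : β < 1) (hγ0 : 0 < γ)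
    (hγ : γ ≤ β * (2 - β) / (8 + β ^ 2))
    (ha : a = ⟪f, u⟫ + ⟪f, d⟫ + γ * β / (1 + ‖f‖ ^ 2) * a * ‖f‖ ^ 2) :
    (1 / γ * ‖u - (γ / (1 + ‖f‖ ^ 2) * (⟪f, u⟫ + (1 - β) * ⟪f, d⟫)) • f‖ ^ 2
      + 1 / γ * ‖(1 - β) • d + (γ / (1 + ‖f‖ ^ 2) * (⟪f, u⟫ + (1 - β) * ⟪f, d⟫)) • f‖ ^ 2)
      - (1 / γ * ‖u‖ ^ 2 + 1 / γ * ‖d + (γ * β / (1 + ‖f‖ ^ 2) * a) • f‖ ^ 2) ≤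
      -(7 / 4) * ‖d‖ ^ 2 - (9 / 16) * (1 / (1 + ‖f‖ ^ 2)) * ⟪f, u⟫ ^ 2 := by
  have hNpos : 0 < 1 + ‖f‖ ^ 2 := by positivity
  have hcs : ⟪f, d⟫ ^ 2 ≤ ‖f‖ ^ 2 * ‖d‖ ^ 2 := by
    rw [← mul_pow]
    exact sq_le_sq' (by linarith [neg_le_of_abs_le (abs_real_inner_le_norm f d)])
      (real_inner_le_norm f d)
  have hγ' : γ * (8 + β ^ 2) ≤ β * (2 - β) := (le_div_iff₀ (by positivity)).1 hγ
  have hγ8 : γ ≤ 1 / 8 := by nlinarith [sq_nonneg (1 - β), mul_pos hγ0 (pow_pos hβ0 2)]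
  have hγβ : γ * β ≤ 1 / 9 := by
    nlinarith [sq_nonneg (1 - β), mul_nonneg hγ0.le (sq_nonneg (1 - β)), mul_pos hγ0 hβ0]
  simp only [norm_sub_sq_real, norm_add_sq_real, norm_smul, inner_smul_left, inner_smul_right,
    mul_pow, Real.norm_eq_abs, sq_abs, real_inner_comm f u, real_inner_comm f d, conj_trivial]
  have hc : 8 + β ^ 2 ≤ β * (2 - β) / γ := (le_div_iff₀ hγ0).2 (by linarith)
  generalize ⟪f, u⟫ = p at *
  generalize ⟪f, d⟫ = q at *
  have hF : 0 ≤ ‖f‖ ^ 2 := sq_nonneg _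
  generalize ‖f‖ ^ 2 = F at *
  have hs0 : 0 ≤ F / (1 + F) := by positivity
  have hs1 : F / (1 + F) ≤ 1 := (div_le_one hNpos).2 (by linarith)
  have hkey := na_cross_terms_le (p := p) (q := q) (a := a) hβ0 hβ1 hγ0 hγ8 hγβ hs0 hs1 (by
    linear_combination ha)
  have hqD : 1 / (1 + F) * q ^ 2 ≤ ‖d‖ ^ 2 := by
    calc 1 / (1 + F) * q ^ 2 ≤ 1 / (1 + F) * (F * ‖d‖ ^ 2) := by gcongr
      _ = F / (1 + F) * ‖d‖ ^ 2 := by ring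
      _ ≤ ‖d‖ ^ 2 := mul_le_of_le_one_left (sq_nonneg _) hs1
  have hmul := mul_le_mul_of_nonneg_left hkey (one_div_pos.2 hNpos).le
  have hdD := mul_le_mul_of_nonneg_right hc (sq_nonneg ‖d‖)
  have hβD : 0 ≤ β ^ 2 * ‖d‖ ^ 2 := by positivity
  have hD := sq_nonneg ‖d‖
  generalize ‖d‖ ^ 2 = D at *
  refine le_trans (b := -(β * (2 - β) / γ * D) + 1 / (1 + F) *
    (-2 * (p + (1 - β) * q) * p + 2 * γ * (F / (1 + F)) * (p + (1 - β) * q) ^ 2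
      + 2 * (1 - β) * (p + (1 - β) * q) * q - 2 * β * a * q
      - γ * β ^ 2 * a ^ 2 * (F / (1 + F)))) (le_of_eq ?_) (by linarith)
  field_simp
  ring

theorem na_lyapunov_decrement
    (n : ℕ) (hn : 1 ≤ n)
    (θstar : EuclideanSpace ℝ (Fin n))
    (φ θ ϑ θbar : ℕ → EuclideanSpace ℝ (Fin n))
    (β γ : ℝ) (hβ0 : 0 < β) (hβ1 : β < 1)
    (hγ0 : 0 < γ) (hγ : γ ≤ β * (2 - β) / (8 + β ^ 2))
    (hθbar : ∀ k, θbar k =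
      θ k - ((γ * β / (1 + ‖φ k‖ ^ 2)) * ⟪φ k, θ k - θstar⟫) • φ k)
    (hθ : ∀ k, θ (k + 1) = θbar k - β • (θbar k - ϑ k))
    (hϑ : ∀ k, ϑ (k + 1) =
      ϑ k - ((γ / (1 + ‖φ k‖ ^ 2)) * ⟪φ k, θ (k + 1) - θstar⟫) • φ k)
    (V : ℕ → ℝ)
    (hV : ∀ k, V k = (1 / γ) * ‖ϑ k - θstar‖ ^ 2 + (1 / γ) * ‖θ k - ϑ k‖ ^ 2)
    :
    (∀ k, V (k + 1) - V k ≤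
      -(7 / 4) * ‖θbar k - ϑ k‖ ^ 2 -
        (9 / 16) * (1 / (1 + ‖φ k‖ ^ 2)) * ⟪φ k, ϑ k - θstar⟫ ^ 2) ∧
    (∀ k, V (k + 1) ≤ V k) := by
  have hdecr : ∀ k, V (k + 1) - V k ≤
      -(7 / 4) * ‖θbar k - ϑ k‖ ^ 2 -
        (9 / 16) * (1 / (1 + ‖φ k‖ ^ 2)) * ⟪φ k, ϑ k - θstar⟫ ^ 2 := by
    intro k
    have hθk : θ k - ϑ k = (θbar k - ϑ k) +
        (γ * β / (1 + ‖φ k‖ ^ 2) * ⟪φ k, θ k - θstar⟫) • φ k := by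
      rw [hθbar k]; abel
    have ha : ⟪φ k, θ k - θstar⟫ = ⟪φ k, ϑ k - θstar⟫ + ⟪φ k, θbar k - ϑ k⟫ +
        γ * β / (1 + ‖φ k‖ ^ 2) * ⟪φ k, θ k - θstar⟫ * ‖φ k‖ ^ 2 := by
      have h := congrArg (fun x => ⟪φ k, x⟫) hθk
      simp only [inner_add_right, inner_smul_right, real_inner_self_eq_norm_sq] at h
      rw [← sub_add_sub_cancel (θ k) (ϑ k) θstar, inner_add_right] at h ⊢
      linarith
    have he : ⟪φ k, θ (k + 1) - θstar⟫ =
        ⟪φ k, ϑ k - θstar⟫ + (1 - β) * ⟪φ k, θbar k - ϑ k⟫ := by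
      rw [hθ k, ← inner_smul_right, ← inner_add_right]
      congr 1
      module
    have hu : ϑ (k + 1) - θstar = (ϑ k - θstar) - (γ / (1 + ‖φ k‖ ^ 2) *
        (⟪φ k, ϑ k - θstar⟫ + (1 - β) * ⟪φ k, θbar k - ϑ k⟫)) • φ k := by
      rw [hϑ k, he]; abel
    have hd : θ (k + 1) - ϑ (k + 1) = (1 - β) • (θbar k - ϑ k) + (γ / (1 + ‖φ k‖ ^ 2) *
        (⟪φ k, ϑ k - θstar⟫ + (1 - β) * ⟪φ k, θbar k - ϑ k⟫)) • φ k := by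
      rw [hϑ k, he, hθ k]; module
    rw [hV, hV, hu, hd, hθk]
    exact na_decrement_step _ _ _ hβ0 hβ1 hγ0 hγ ha
  refine ⟨hdecr, fun k => ?_⟩
  have hD : 0 ≤ 7 / 4 * ‖θbar k - ϑ k‖ ^ 2 := by positivity
  have hP : 0 ≤ 9 / 16 * (1 / (1 + ‖φ k‖ ^ 2)) * ⟪φ k, ϑ k - θstar⟫ ^ 2 := by positivity
  linarith [hdecr k]
end

section
/- Theorem 2(i) (boundedness of the Nesterov-acceleration tuner): if 0 < β < 1 and 0 < γ ≤ β(2−β)/(8+β²), then for every k ≥ 0, ‖ϑ_k − θ*‖² ≤ γ V_0 and ‖θ_k − ϑ_k‖² ≤ γ V_0; hence the sequences (ϑ_k − θ*) and (θ_k − ϑ_k) are bounded (belong to ℓ∞). -/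
open scoped RealInnerProductSpace

/-- Up to the factor `γ / 𝒩`, the one-step increment of the Lyapunov function is bounded by this
quadratic form in `r = ⟪φ, θ - θ*⟫` and `q = ⟪φ, θ - ϑ⟫`. -/
theorem lyapunov_increment_form_nonpos {β g r q e : ℝ} (hβ0 : 0 < β) (hβ1 : β < 1)
    (hg0 : 0 ≤ g) (hg : g ≤ 1 / 8)
    (he : e = (1 - g * (β * (1 - β))) * r - β * q) :
    -(8 + β ^ 2) * q ^ 2 - 2 * e * (r - q) + g * e ^ 2
      + 2 * (1 - β) * q * (e - β * (1 - β) * r) + g * (e - β * (1 - β) * r) ^ 2 ≤ 0 := by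
  have sq_le : ∀ t : ℝ, 0 ≤ t → t ≤ 1 → (t * r - β * q) ^ 2 ≤ 2 * r ^ 2 + 2 * q ^ 2 := by
    intro t ht0 ht1
    have h1 : t ^ 2 * r ^ 2 ≤ 1 * r ^ 2 := by
      gcongr
      exact pow_le_one₀ ht0 ht1
    have h2 : β ^ 2 * q ^ 2 ≤ 1 * q ^ 2 := by
      gcongr
      exact pow_le_one₀ hβ0.le hβ1.le
    nlinarith [sq_nonneg (t * r + β * q)]
  obtain ⟨c, hc⟩ : ∃ c, c = β * (1 - β) := ⟨_, rfl⟩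
  have hc0 : 0 ≤ c := hc ▸ mul_nonneg hβ0.le (by linarith)
  have hc1 : c ≤ 1 / 4 := by nlinarith [sq_nonneg (β - 1 / 2)]
  obtain ⟨t, ht⟩ : ∃ t, t = 1 - g * c := ⟨_, rfl⟩
  have ht0 : 31 / 32 ≤ t := by nlinarith
  have ht1 : t ≤ 1 := by nlinarith
  rw [← hc, ← ht] at he
  rw [← hc]
  have hA : g * e ^ 2 ≤ 1 / 8 * (2 * r ^ 2 + 2 * q ^ 2) := by
    rw [he]
    exact mul_le_mul hg (sq_le t (by linarith) ht1) (sq_nonneg _) (by norm_num)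
  have hB : g * (e - c * r) ^ 2 ≤ 1 / 8 * (2 * r ^ 2 + 2 * q ^ 2) := by
    have : e - c * r = (t - c) * r - β * q := by rw [he]; ring
    rw [this]
    exact mul_le_mul hg (sq_le (t - c) (by linarith) (by linarith)) (sq_nonneg _) (by norm_num)
  obtain ⟨x, hx⟩ : ∃ x, x = 2 * β + 2 * (2 - β) * t - 2 * (1 - β) * c := ⟨_, rfl⟩
  have hx0 : 0 ≤ x := by nlinarith
  have hx4 : x ≤ 4 := by nlinarith
  have hxx : x ^ 2 ≤ 16 := by nlinarith
  have hmain : -2 * t * r ^ 2 + x * (r * q) - (8 + β ^ 2 + 2 * (2 - β) * β) * q ^ 2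
      + 1 / 2 * (r ^ 2 + q ^ 2) ≤ 0 := by
    have h1 : 31 / 32 * r ^ 2 ≤ t * r ^ 2 := by gcongr
    have h2 : 0 ≤ (β ^ 2 + 2 * (2 - β) * β) * q ^ 2 := by
      have : 0 < 2 - β := by linarith
      positivity
    have h3 : x ^ 2 * q ^ 2 ≤ 16 * q ^ 2 := by gcongr
    nlinarith [sq_nonneg (2 * r - x * q), sq_nonneg r, sq_nonneg q]
  have heq : -(8 + β ^ 2) * q ^ 2 - 2 * e * (r - q) + 2 * (1 - β) * q * (e - c * r)
      = -2 * t * r ^ 2 + x * (r * q) - (8 + β ^ 2 + 2 * (2 - β) * β) * q ^ 2 := by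
    rw [he, hx]; ring
  linarith

/-- One step of the tuner, in the errors `a = ϑ - θ*` and `d = θ - ϑ`, does not increase
`‖a‖² + ‖d‖²`. -/
theorem lyapunov_step_le {E : Type*} [NormedAddCommGroup E] [InnerProductSpace ℝ E]
    {a d a' d' v : E} {β γ e : ℝ} (hβ0 : 0 < β) (hβ1 : β < 1)
    (hγ0 : 0 < γ) (hγ : γ ≤ β * (2 - β) / (8 + β ^ 2))
    (he : e = ⟪v, a + (1 - β) • d
      - ((1 - β) * (γ * β / (1 + ‖v‖ ^ 2)) * ⟪v, a + d⟫) • v⟫)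
    (ha' : a' = a - (γ / (1 + ‖v‖ ^ 2) * e) • v)
    (hd' : d' = (1 - β) • d
      + (γ / (1 + ‖v‖ ^ 2) * (e - β * (1 - β) * ⟪v, a + d⟫)) • v) :
    ‖a'‖ ^ 2 + ‖d'‖ ^ 2 ≤ ‖a‖ ^ 2 + ‖d‖ ^ 2 := by
  obtain ⟨m, hm⟩ : ∃ m, m = ‖v‖ ^ 2 := ⟨_, rfl⟩
  have hm0 : 0 ≤ m := hm ▸ sq_nonneg _
  obtain ⟨u, hu⟩ : ∃ u, u = (1 + m)⁻¹ := ⟨_, rfl⟩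
  have hu0 : 0 < u := by rw [hu]; positivity
  have hum : u * (1 + m) = 1 := by rw [hu]; field_simp
  obtain ⟨p, hp⟩ : ∃ p, p = ⟪v, a⟫ := ⟨_, rfl⟩
  obtain ⟨q, hq⟩ : ∃ q, q = ⟪v, d⟫ := ⟨_, rfl⟩
  have hcs : q ^ 2 ≤ m * ‖d‖ ^ 2 := by
    rw [hq, hm, ← mul_pow]
    exact sq_le_sq' (neg_le_of_abs_le (abs_real_inner_le_norm v d)) (real_inner_le_norm v d)
  simp only [inner_add_right, inner_sub_right, inner_smul_right, real_inner_self_eq_norm_sq,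
    ← hm, ← hp, ← hq, div_eq_mul_inv, ← hu] at he ha' hd'
  have h8 : 0 < 8 + β ^ 2 := by positivity
  have hγ' : γ * (8 + β ^ 2) ≤ β * (2 - β) := (le_div_iff₀ h8).mp hγ
  have hγ8 : γ ≤ 1 / 8 := by nlinarith [sq_nonneg (β - 1), mul_pos hγ0 (pow_pos hβ0 2)]
  have hQ := lyapunov_increment_form_nonpos (β := β) (g := γ * (u * m)) (r := p + q) (q := q)
    (e := e) hβ0 hβ1 (by positivity) (by nlinarith) (by rw [he]; ring)
  have hN : q ^ 2 * u ≤ ‖d‖ ^ 2 := by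
    have h1 : q ^ 2 * u ≤ m * ‖d‖ ^ 2 * u := by gcongr
    nlinarith [mul_nonneg hu0.le (sq_nonneg ‖d‖)]
  have hdrop : γ * (8 + β ^ 2) * (q ^ 2 * u) ≤ β * (2 - β) * ‖d‖ ^ 2 := by
    apply mul_le_mul hγ' hN (by positivity)
    nlinarith
  have hna : ‖a'‖ ^ 2 = ‖a‖ ^ 2 - 2 * (γ * u * e) * p + (γ * u * e) ^ 2 * m := by
    rw [ha', norm_sub_sq_real, inner_smul_right, real_inner_comm, ← hp, norm_smul, mul_pow,
      ← hm, Real.norm_eq_abs, sq_abs]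
    ring
  have hnd : ‖d'‖ ^ 2 = (1 - β) ^ 2 * ‖d‖ ^ 2
      + 2 * (1 - β) * (γ * u * (e - β * (1 - β) * (p + q))) * q
      + (γ * u * (e - β * (1 - β) * (p + q))) ^ 2 * m := by
    rw [hd', norm_add_sq_real, inner_smul_right, real_inner_smul_left, real_inner_comm, ← hq,
      norm_smul, norm_smul, mul_pow, mul_pow, ← hm, Real.norm_eq_abs, Real.norm_eq_abs, sq_abs,
      sq_abs]
    ring
  rw [hna, hnd]
  have := mul_nonpos_of_nonneg_of_nonpos (mul_pos hγ0 hu0).le hQ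
  linarith

theorem na_boundedness
    (n : ℕ) (hn : 1 ≤ n)
    (θstar : EuclideanSpace ℝ (Fin n))
    (φ θ ϑ θbar : ℕ → EuclideanSpace ℝ (Fin n))
    (β γ : ℝ) (hβ0 : 0 < β) (hβ1 : β < 1)
    (hγ0 : 0 < γ) (hγ : γ ≤ β * (2 - β) / (8 + β ^ 2))
    (hθbar : ∀ k, θbar k =
      θ k - ((γ * β / (1 + ‖φ k‖ ^ 2)) * ⟪φ k, θ k - θstar⟫) • φ k)
    (hθ : ∀ k, θ (k + 1) = θbar k - β • (θbar k - ϑ k))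
    (hϑ : ∀ k, ϑ (k + 1) =
      ϑ k - ((γ / (1 + ‖φ k‖ ^ 2)) * ⟪φ k, θ (k + 1) - θstar⟫) • φ k)
    (V : ℕ → ℝ)
    (hV : ∀ k, V k = (1 / γ) * ‖ϑ k - θstar‖ ^ 2 + (1 / γ) * ‖θ k - ϑ k‖ ^ 2)
    :
    (∀ k, ‖ϑ k - θstar‖ ^ 2 ≤ γ * V 0 ∧ ‖θ k - ϑ k‖ ^ 2 ≤ γ * V 0) ∧
    (∃ C : ℝ, ∀ k, ‖ϑ k - θstar‖ ≤ C ∧ ‖θ k - ϑ k‖ ≤ C) := by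
  have hstep : ∀ k, ‖ϑ (k + 1) - θstar‖ ^ 2 + ‖θ (k + 1) - ϑ (k + 1)‖ ^ 2
      ≤ ‖ϑ k - θstar‖ ^ 2 + ‖θ k - ϑ k‖ ^ 2 := by
    intro k
    have herr : θ (k + 1) - θstar = (ϑ k - θstar) + (1 - β) • (θ k - ϑ k)
        - ((1 - β) * (γ * β / (1 + ‖φ k‖ ^ 2))
          * ⟪φ k, (ϑ k - θstar) + (θ k - ϑ k)⟫) • φ k := by
      rw [hθ, hθbar, show (ϑ k - θstar) + (θ k - ϑ k) = θ k - θstar by abel]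
      module
    apply lyapunov_step_le (v := φ k) (e := ⟪φ k, θ (k + 1) - θstar⟫) hβ0 hβ1 hγ0 hγ
    · rw [herr]
    · rw [hϑ]
      abel
    · have hsplit : θ (k + 1) - ϑ (k + 1) = (θ (k + 1) - θstar) - (ϑ k - θstar)
          + (γ / (1 + ‖φ k‖ ^ 2) * ⟪φ k, θ (k + 1) - θstar⟫) • φ k := by
        rw [hϑ k]
        abel
      rw [hsplit]
      generalize ⟪φ k, θ (k + 1) - θstar⟫ = e
      rw [herr]
      module
  have hγV : ∀ k, γ * V k = ‖ϑ k - θstar‖ ^ 2 + ‖θ k - ϑ k‖ ^ 2 := by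
    intro k
    rw [hV]
    field_simp
  have hle : ∀ k, ‖ϑ k - θstar‖ ^ 2 + ‖θ k - ϑ k‖ ^ 2 ≤ γ * V 0 := by
    intro k
    induction k with
    | zero => exact (hγV 0).ge
    | succ k ih => exact (hstep k).trans ih
  have hbound : ∀ k, ‖ϑ k - θstar‖ ^ 2 ≤ γ * V 0 ∧ ‖θ k - ϑ k‖ ^ 2 ≤ γ * V 0 := fun k =>
    ⟨(le_add_of_nonneg_right (sq_nonneg _)).trans (hle k),
      (le_add_of_nonneg_left (sq_nonneg _)).trans (hle k)⟩
  exact ⟨hbound, √(γ * V 0), fun k =>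
    ⟨Real.le_sqrt_of_sq_le (hbound k).1, Real.le_sqrt_of_sq_le (hbound k).2⟩⟩
end

section
/- Summed Lyapunov decrement for the Nesterov-acceleration tuner over a window: if 0 < β < 1 and 0 < γ ≤ β(2−β)/(8+β²), then for every integer k ≥ ΔT (ΔT ≥ 1), V_k − V_{k−ΔT} ≤ −(7/4)(1/ΔT)·W₁² − (9/16)(1/ΔT)·W₂². -/
open scoped RealInnerProductSpace

/-- The gain condition forces the step size to be at most `1 / 8`. -/
theorem gain_le_one_eighth {β γ : ℝ} (hβ0 : 0 < β) (hβ1 : β < 1)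
    (hγ : γ ≤ β * (2 - β) / (8 + β ^ 2)) : γ ≤ 1 / 8 := by
  refine hγ.trans ?_
  rw [div_le_div_iff₀ (by positivity) (by norm_num)]
  nlinarith

/-- One-step Lyapunov decrement for a normalized regressor `p`, where `e` is the error of the slow
iterate, `w` the gap between the two iterates and `d` the gap after the gradient step. -/
theorem normalized_step_decrement {F : Type*} [NormedAddCommGroup F] [InnerProductSpace ℝ F]
    {p e w d : F} {β γ c : ℝ} (hp : ‖p‖ ^ 2 ≤ 1) (hβ0 : 0 < β) (hβ1 : β < 1) (hγ0 : 0 < γ)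
    (hγ : γ ≤ β * (2 - β) / (8 + β ^ 2))
    (hd : d = w - (γ * β * ⟪p, e + w⟫) • p) (hc : c = ⟪p, e + (1 - β) • d⟫) :
    ‖e - (γ * c) • p‖ ^ 2 + ‖(1 - β) • d + (γ * c) • p‖ ^ 2 - (‖e‖ ^ 2 + ‖w‖ ^ 2) ≤
      -γ * (7 / 4 * ‖d‖ ^ 2 + 9 / 16 * ⟪p, e⟫ ^ 2) := by
  have hγ8 := gain_le_one_eighth hβ0 hβ1 hγ
  obtain ⟨a, ha⟩ : ∃ a, a = ⟪p, e + w⟫ := ⟨_, rfl⟩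
  rw [← ha] at hd
  obtain rfl : w = d + (γ * β * a) • p := by rw [hd]; abel
  simp only [inner_add_right, real_inner_smul_right, real_inner_self_eq_norm_sq] at ha hc
  have hD : ⟪p, d⟫ ^ 2 ≤ ‖d‖ ^ 2 := by
    have h := real_inner_mul_inner_self_le p d
    simp only [real_inner_self_eq_norm_sq] at h
    nlinarith [sq_nonneg ‖d‖]
  rw [norm_sub_sq_real, norm_add_sq_real, norm_add_sq_real]
  simp only [norm_smul, real_inner_smul_right, mul_pow, Real.norm_eq_abs,
    sq_abs, real_inner_comm p]
  have hs := sq_nonneg ‖p‖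
  generalize ‖p‖ ^ 2 = s at *
  generalize ⟪p, d⟫ = D at *
  generalize ⟪p, e⟫ = E at *
  have hm := (sq_nonneg D).trans hD
  generalize ‖d‖ ^ 2 = m at *
  have hgain : γ * (8 + β ^ 2) * m ≤ β * (2 - β) * m :=
    mul_le_mul_of_nonneg_right ((le_div_iff₀ (by positivity)).mp hγ) hm
  have hgs0 : 0 ≤ γ * s := by positivity
  have hgs : γ * s ≤ 1 / 8 := by nlinarith
  have ht : γ * s * β ≤ 1 / 8 := by nlinarith
  have haD : -(2 / 7 * E ^ 2) ≤ a * D := by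
    have h1 : (1 - γ * s * β) * (a * D) = D ^ 2 + D * E := by linear_combination D * ha
    by_contra! hlt
    nlinarith [sq_nonneg (D + E / 2), sq_nonneg E]
  have hβaD : -(2 / 7 * E ^ 2) ≤ β * (a * D) := by nlinarith [sq_nonneg E]
  have hb : (1 - β) ^ 2 ≤ 1 := by nlinarith
  have hbD : (1 - β) ^ 2 * D ^ 2 ≤ m := by nlinarith [sq_nonneg D]
  have hc2 : γ * s * c ^ 2 ≤ 1 / 4 * (E ^ 2 + m) := by
    have : c ^ 2 ≤ 2 * (E ^ 2 + m) := by
      rw [hc]; nlinarith [sq_nonneg (E - (1 - β) * D)]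
    nlinarith [sq_nonneg c]
  have hcross : -c * E + (1 - β) * c * D = -E ^ 2 + (1 - β) ^ 2 * D ^ 2 := by
    rw [hc]; ring
  have hmain : -2 * c * E + 2 * (γ * s * c ^ 2) + 2 * (1 - β) * c * D - 2 * (β * (a * D)) ≤
      (8 + β ^ 2) * m - (7 / 4 * m + 9 / 16 * E ^ 2) := by
    nlinarith [sq_nonneg E, mul_nonneg (sq_nonneg β) hm]
  have hdrop : 0 ≤ γ ^ 2 * β ^ 2 * a ^ 2 * s := by positivity
  nlinarith [mul_le_mul_of_nonneg_left hmain hγ0.le]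

theorem na_summed_decrement
    (n : ℕ) (hn : 1 ≤ n)
    (θstar : EuclideanSpace ℝ (Fin n))
    (φ θ ϑ θbar : ℕ → EuclideanSpace ℝ (Fin n))
    (β γ : ℝ) (hβ0 : 0 < β) (hβ1 : β < 1)
    (hγ0 : 0 < γ) (hγ : γ ≤ β * (2 - β) / (8 + β ^ 2))
    (hθbar : ∀ k, θbar k =
      θ k - ((γ * β / (1 + ‖φ k‖ ^ 2)) * ⟪φ k, θ k - θstar⟫) • φ k)
    (hθ : ∀ k, θ (k + 1) = θbar k - β • (θbar k - ϑ k))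
    (hϑ : ∀ k, ϑ (k + 1) =
      ϑ k - ((γ / (1 + ‖φ k‖ ^ 2)) * ⟪φ k, θ (k + 1) - θstar⟫) • φ k)
    (V : ℕ → ℝ)
    (hV : ∀ k, V k = (1 / γ) * ‖ϑ k - θstar‖ ^ 2 + (1 / γ) * ‖θ k - ϑ k‖ ^ 2)
    (ΔT : ℕ) (hΔT : 1 ≤ ΔT) (k : ℕ) (hk : ΔT ≤ k)
    (W₁ W₂ : ℝ)
    (hW₁ : W₁ = ∑ i ∈ Finset.Ico (k - ΔT) k, ‖θbar i - ϑ i‖)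
    (hW₂ : W₂ = ∑ i ∈ Finset.Ico (k - ΔT) k,
      (1 / Real.sqrt (1 + ‖φ i‖ ^ 2)) * |⟪φ i, ϑ i - θstar⟫|)
    :
    V k - V (k - ΔT) ≤
      -(7 / 4) * (1 / (ΔT : ℝ)) * W₁ ^ 2 - (9 / 16) * (1 / (ΔT : ℝ)) * W₂ ^ 2 := by
  have hstep (i : ℕ) : V (i + 1) - V i ≤ -(7 / 4 * ‖θbar i - ϑ i‖ ^ 2 +
      9 / 16 * ((1 / Real.sqrt (1 + ‖φ i‖ ^ 2)) * |⟪φ i, ϑ i - θstar⟫|) ^ 2) := by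
    have hN : 0 < 1 + ‖φ i‖ ^ 2 := by positivity
    obtain ⟨r, hr⟩ : ∃ r, r = 1 / Real.sqrt (1 + ‖φ i‖ ^ 2) := ⟨_, rfl⟩
    have hr2 : r ^ 2 = 1 / (1 + ‖φ i‖ ^ 2) := by rw [hr, div_pow, one_pow, Real.sq_sqrt hN.le]
    have hp : ‖r • φ i‖ ^ 2 ≤ 1 := by
      rw [norm_smul, mul_pow, Real.norm_eq_abs, sq_abs, hr2, one_div_mul_eq_div, div_le_one hN]
      linarith
    have hscale (x : ℝ) (v : EuclideanSpace ℝ (Fin n)) :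
        (x / (1 + ‖φ i‖ ^ 2) * ⟪φ i, v⟫) • φ i = (x * ⟪r • φ i, v⟫) • (r • φ i) := by
      rw [real_inner_smul_left, smul_smul, div_eq_mul_one_div, ← hr2]
      congr 1
      ring
    have hθerr : θ (i + 1) - θstar = (ϑ i - θstar) + (1 - β) • (θbar i - ϑ i) := by
      rw [hθ]; module
    have hd : θbar i - ϑ i = (θ i - ϑ i) -
        (γ * β * ⟪r • φ i, (ϑ i - θstar) + (θ i - ϑ i)⟫) • (r • φ i) := by
      rw [hθbar, hscale, sub_right_comm, add_comm, sub_add_sub_cancel]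
    have hϑerr : ϑ (i + 1) - θstar = (ϑ i - θstar) -
        (γ * ⟪r • φ i, (ϑ i - θstar) + (1 - β) • (θbar i - ϑ i)⟫) • (r • φ i) := by
      rw [hϑ, hscale, hθerr, sub_right_comm]
    have hgap : θ (i + 1) - ϑ (i + 1) = (1 - β) • (θbar i - ϑ i) +
        (γ * ⟪r • φ i, (ϑ i - θstar) + (1 - β) • (θbar i - ϑ i)⟫) • (r • φ i) := by
      rw [← sub_sub_sub_cancel_right _ _ θstar, hϑerr, hθerr]; abel
    have h := normalized_step_decrement hp hβ0 hβ1 hγ0 hγ hd rfl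
    rw [← hϑerr, ← hgap, real_inner_smul_left] at h
    rw [hV, hV, ← hr, mul_pow, sq_abs, ← mul_pow, ← mul_add, ← mul_add, ← mul_sub,
      one_div_mul_eq_div, div_le_iff₀ hγ0]
    linarith
  have hsum := Finset.sum_le_sum fun i (_ : i ∈ Finset.Ico (k - ΔT) k) ↦ hstep i
  rw [Finset.sum_Ico_sub V (Nat.sub_le k ΔT), Finset.sum_neg_distrib, Finset.sum_add_distrib,
    ← Finset.mul_sum, ← Finset.mul_sum] at hsum
  have hT : (0 : ℝ) < ΔT := by exact_mod_cast hΔT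
  have hcard : (Finset.Ico (k - ΔT) k).card = ΔT := by rw [Nat.card_Ico]; omega
  have hCS (f : ℕ → ℝ) : 1 / (ΔT : ℝ) * (∑ i ∈ Finset.Ico (k - ΔT) k, f i) ^ 2 ≤
      ∑ i ∈ Finset.Ico (k - ΔT) k, f i ^ 2 := by
    rw [one_div_mul_eq_div, div_le_iff₀' hT]
    simpa [hcard] using sq_sum_le_card_mul_sum_sq (s := Finset.Ico (k - ΔT) k) (f := f)
  have h₁ := hCS fun i ↦ ‖θbar i - ϑ i‖
  have h₂ := hCS fun i ↦ (1 / Real.sqrt (1 + ‖φ i‖ ^ 2)) * |⟪φ i, ϑ i - θstar⟫|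
  rw [← hW₁] at h₁
  rw [← hW₂] at h₂
  linarith
end

section
/- Nesterov-acceleration Case 1(a) contraction: suppose 0 < β < 1, 0 < γ ≤ β(2−β)/(8+β²), 0 < λ < 1, η > 0, and k ≥ ΔT. If ‖ϑ_{k−ΔT} − θ*‖² ≥ λγ V_{k−ΔT} and W₁ ≥ η‖ϑ_{k−ΔT} − θ*‖, then V_k ≤ (1 − (7/4)(λγη²/ΔT)) V_{k−ΔT}. -/
open scoped RealInnerProductSpace

/-- The scalar inequality behind the one-step decrease: `x`, `y`, `q` are the components of
`ϑ - θ*`, `θbar - ϑ`, `θ - θ*` along the normalized regressor, whose squared norm is `m`, and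
`D` is the squared norm of `θbar - ϑ`. -/
lemma scalar_decrease {β γ m D x y q : ℝ} (hβ0 : 0 < β) (hβ1 : β < 1) (hγ0 : 0 < γ)
    (hγ : γ * (8 + β ^ 2) ≤ β * (2 - β)) (hm0 : 0 ≤ m) (hm1 : m ≤ 1) (hyD : y ^ 2 ≤ D)
    (hq : (1 - γ * β * m) * q = x + y) :
    -(β * (2 - β)) * D + 2 * γ ^ 2 * m * (x + (1 - β) * y) ^ 2
      - 2 * γ * (x ^ 2 - (1 - β) ^ 2 * y ^ 2) - 2 * γ * β * q * y - γ ^ 2 * β ^ 2 * m * q ^ 2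
      ≤ -(7 / 4) * γ * D := by
  have hD : 0 ≤ D := (sq_nonneg y).trans hyD
  have hγ8 : γ ≤ 1 / 8 := by nlinarith [sq_nonneg (1 - β), mul_pos hγ0 (pow_pos hβ0 2)]
  have hg : γ * β * m ≤ 1 / 8 := by
    calc γ * β * m ≤ (1 / 8) * 1 * 1 := by gcongr
      _ = 1 / 8 := by norm_num
  have hβsq : (1 - β) ^ 2 ≤ 1 := by nlinarith
  have hβy : (1 - β) ^ 2 * y ^ 2 ≤ y ^ 2 := mul_le_of_le_one_left (sq_nonneg y) hβsq
  have hp : (x + (1 - β) * y) ^ 2 ≤ 2 * x ^ 2 + 2 * y ^ 2 := by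
    nlinarith [sq_nonneg (x - (1 - β) * y)]
  have hmp : 2 * (γ * m) * (x + (1 - β) * y) ^ 2 ≤ (1 / 2) * (x ^ 2 + y ^ 2) := by
    have hγm : γ * m ≤ 1 / 8 := (mul_le_of_le_one_right hγ0.le hm1).trans hγ8
    nlinarith [mul_le_mul_of_nonneg_right hγm (sq_nonneg (x + (1 - β) * y))]
  have hqsq : 49 / 64 * q ^ 2 ≤ 2 * x ^ 2 + 2 * y ^ 2 := by
    have h : 49 / 64 * q ^ 2 ≤ (1 - γ * β * m) ^ 2 * q ^ 2 := by
      gcongr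
      nlinarith
    rw [← mul_pow, hq] at h
    nlinarith [sq_nonneg (x - y)]
  have hqy : -(2 * β * q * y) ≤ q ^ 2 / 2 + 2 * y ^ 2 := by
    nlinarith [sq_nonneg (q + 2 * β * y),
      mul_le_of_le_one_left (sq_nonneg y) (show β ^ 2 ≤ 1 by nlinarith)]
  have hquad : 0 ≤ γ ^ 2 * β ^ 2 * m * q ^ 2 := by positivity
  have hbracket : 2 * (γ * m) * (x + (1 - β) * y) ^ 2 - 2 * (x ^ 2 - (1 - β) ^ 2 * y ^ 2)
      - 2 * β * q * y ≤ 25 / 4 * D := by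
    nlinarith [sq_nonneg x, sq_nonneg y]
  have hDγ : γ * (8 + β ^ 2) * D ≤ β * (2 - β) * D := mul_le_mul_of_nonneg_right hγ hD
  have hβD : 0 ≤ γ * β ^ 2 * D := by positivity
  nlinarith [mul_le_mul_of_nonneg_left hbracket hγ0.le]

/-- One-step decrease of the scaled Lyapunov function, with `a = ϑ - θ*`, `e = θ - ϑ`,
`d = θbar - ϑ` and `u` the normalized regressor. -/
lemma lyapunov_step {E : Type*} [NormedAddCommGroup E] [InnerProductSpace ℝ E] {β γ : ℝ}
    (hβ0 : 0 < β) (hβ1 : β < 1) (hγ0 : 0 < γ) (hγ : γ * (8 + β ^ 2) ≤ β * (2 - β))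
    {u a d e : E} (hu : ‖u‖ ≤ 1) (hd : d = e - (γ * β * ⟪u, a + e⟫) • u) :
    ‖a - (γ * ⟪u, a + (1 - β) • d⟫) • u‖ ^ 2
        + ‖(1 - β) • d + (γ * ⟪u, a + (1 - β) • d⟫) • u‖ ^ 2
      ≤ ‖a‖ ^ 2 + ‖e‖ ^ 2 - 7 / 4 * γ * ‖d‖ ^ 2 := by
  set q := ⟪u, a + e⟫ with hq_def
  have he : e = d + (γ * β * q) • u := by rw [hd]; abel
  have hu2 : ‖u‖ ^ 2 ≤ 1 := pow_le_one₀ (norm_nonneg u) hu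
  have hy : ⟪u, d⟫ ^ 2 ≤ ‖d‖ ^ 2 := by
    rw [sq_le_sq, abs_of_nonneg (norm_nonneg d)]
    exact (abs_real_inner_le_norm u d).trans (mul_le_of_le_one_left (norm_nonneg d) hu)
  have hq : (1 - γ * β * ‖u‖ ^ 2) * q = ⟪u, a⟫ + ⟪u, d⟫ := by
    have h : q = ⟪u, a⟫ + (⟪u, d⟫ + γ * β * q * ‖u‖ ^ 2) := by
      conv_lhs => rw [hq_def, he]
      rw [inner_add_right, inner_add_right, real_inner_smul_right, real_inner_self_eq_norm_sq]
    linarith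
  have hmain := scalar_decrease hβ0 hβ1 hγ0 hγ (sq_nonneg ‖u‖) hu2 hy hq
  clear_value q
  rw [he, norm_sub_sq_real, norm_add_sq_real, norm_add_sq_real]
  simp only [inner_add_right, real_inner_smul_right, norm_smul, mul_pow,
    Real.norm_eq_abs, sq_abs, real_inner_comm u]
  linarith

theorem na_case1a
    (n : ℕ) (hn : 1 ≤ n)
    (θstar : EuclideanSpace ℝ (Fin n))
    (φ θ ϑ θbar : ℕ → EuclideanSpace ℝ (Fin n))
    (β γ : ℝ) (hβ0 : 0 < β) (hβ1 : β < 1)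
    (hγ0 : 0 < γ) (hγ : γ ≤ β * (2 - β) / (8 + β ^ 2))
    (hθbar : ∀ k, θbar k =
      θ k - ((γ * β / (1 + ‖φ k‖ ^ 2)) * ⟪φ k, θ k - θstar⟫) • φ k)
    (hθ : ∀ k, θ (k + 1) = θbar k - β • (θbar k - ϑ k))
    (hϑ : ∀ k, ϑ (k + 1) =
      ϑ k - ((γ / (1 + ‖φ k‖ ^ 2)) * ⟪φ k, θ (k + 1) - θstar⟫) • φ k)
    (V : ℕ → ℝ)
    (hV : ∀ k, V k = (1 / γ) * ‖ϑ k - θstar‖ ^ 2 + (1 / γ) * ‖θ k - ϑ k‖ ^ 2)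
    (ΔT : ℕ) (hΔT : 1 ≤ ΔT) (k : ℕ) (hk : ΔT ≤ k)
    (W₁ W₂ : ℝ)
    (hW₁ : W₁ = ∑ i ∈ Finset.Ico (k - ΔT) k, ‖θbar i - ϑ i‖)
    (hW₂ : W₂ = ∑ i ∈ Finset.Ico (k - ΔT) k,
      (1 / Real.sqrt (1 + ‖φ i‖ ^ 2)) * |⟪φ i, ϑ i - θstar⟫|)
    (lam η : ℝ) (hlam0 : 0 < lam) (hlam1 : lam < 1) (hη : 0 < η)
    (hbig : lam * γ * V (k - ΔT) ≤ ‖ϑ (k - ΔT) - θstar‖ ^ 2)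
    (hW1 : η * ‖ϑ (k - ΔT) - θstar‖ ≤ W₁) :
    V k ≤ (1 - (7 / 4) * (lam * γ * η ^ 2 / (ΔT : ℝ))) * V (k - ΔT) := by
  have hγ' : γ * (8 + β ^ 2) ≤ β * (2 - β) := (le_div_iff₀ (by positivity)).1 hγ
  have hstep : ∀ i, V (i + 1) ≤ V i - 7 / 4 * ‖θbar i - ϑ i‖ ^ 2 := by
    intro i
    set N := 1 + ‖φ i‖ ^ 2 with hN
    have hN0 : 0 < N := by positivity
    set u := (Real.sqrt N)⁻¹ • φ i with hu
    have hproj : ∀ (c : ℝ) (w : EuclideanSpace ℝ (Fin n)),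
        (c / N * ⟪φ i, w⟫) • φ i = (c * ⟪u, w⟫) • u := by
      intro c w
      rw [hu, real_inner_smul_left, smul_smul]
      congr 1
      have hs : (Real.sqrt N)⁻¹ * (Real.sqrt N)⁻¹ = N⁻¹ := by
        rw [← mul_inv, Real.mul_self_sqrt hN0.le]
      rw [div_eq_mul_inv, ← hs]
      ring
    have hu1 : ‖u‖ ≤ 1 := by
      rw [hu, norm_smul, norm_inv, Real.norm_of_nonneg (Real.sqrt_nonneg N),
        inv_mul_le_one₀ (Real.sqrt_pos.2 hN0)]
      exact Real.le_sqrt_of_sq_le (by linarith)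
    have hθbar_u := hθbar i
    have hϑ_u := hϑ i
    rw [← hN, hproj] at hθbar_u hϑ_u
    have hθ_err : θ (i + 1) - θstar = (ϑ i - θstar) + (1 - β) • (θbar i - ϑ i) := by
      rw [hθ i]; module
    rw [hθ_err] at hϑ_u
    have hsplit : ϑ i - θstar + (θ i - ϑ i) = θ i - θstar := by abel
    have hdecr := lyapunov_step hβ0 hβ1 hγ0 hγ' (a := ϑ i - θstar) (d := θbar i - ϑ i)
      (e := θ i - ϑ i) hu1 (by rw [hsplit, hθbar_u]; abel)
    have hϑ_err : ϑ (i + 1) - θstar = ϑ i - θstar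
        - (γ * ⟪u, ϑ i - θstar + (1 - β) • (θbar i - ϑ i)⟫) • u := by
      rw [hϑ_u]; abel
    have hgap : θ (i + 1) - ϑ (i + 1) = (1 - β) • (θbar i - ϑ i)
        + (γ * ⟪u, ϑ i - θstar + (1 - β) • (θbar i - ϑ i)⟫) • u := by
      rw [← sub_sub_sub_cancel_right _ _ θstar, hθ_err, hϑ_err]; abel
    rw [← hϑ_err, ← hgap] at hdecr
    rw [hV, hV, ← mul_add, ← mul_add]
    calc 1 / γ * (‖ϑ (i + 1) - θstar‖ ^ 2 + ‖θ (i + 1) - ϑ (i + 1)‖ ^ 2)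
        ≤ 1 / γ * (‖ϑ i - θstar‖ ^ 2 + ‖θ i - ϑ i‖ ^ 2 - 7 / 4 * γ * ‖θbar i - ϑ i‖ ^ 2) := by
          gcongr
      _ = _ := by field_simp
  have hsum : V k ≤ V (k - ΔT)
      - 7 / 4 * ∑ i ∈ Finset.Ico (k - ΔT) k, ‖θbar i - ϑ i‖ ^ 2 := by
    have h : ∑ i ∈ Finset.Ico (k - ΔT) k, (V (i + 1) - V i)
        ≤ ∑ i ∈ Finset.Ico (k - ΔT) k, -(7 / 4 * ‖θbar i - ϑ i‖ ^ 2) :=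
      Finset.sum_le_sum fun i _ => by linarith [hstep i]
    rw [Finset.sum_Ico_sub V (Nat.sub_le k ΔT), Finset.sum_neg_distrib, ← Finset.mul_sum] at h
    linarith
  have hcs : W₁ ^ 2 ≤ ΔT * ∑ i ∈ Finset.Ico (k - ΔT) k, ‖θbar i - ϑ i‖ ^ 2 := by
    have h := sq_sum_le_card_mul_sum_sq (s := Finset.Ico (k - ΔT) k)
      (f := fun i => ‖θbar i - ϑ i‖)
    rwa [Nat.card_Ico, Nat.sub_sub_self hk, ← hW₁] at h
  have hΔT0 : (0 : ℝ) < ΔT := by exact_mod_cast hΔT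
  have hW : η ^ 2 * (lam * γ * V (k - ΔT)) ≤ W₁ ^ 2 := by
    calc η ^ 2 * (lam * γ * V (k - ΔT)) ≤ η ^ 2 * ‖ϑ (k - ΔT) - θstar‖ ^ 2 := by gcongr
      _ = (η * ‖ϑ (k - ΔT) - θstar‖) ^ 2 := by ring
      _ ≤ W₁ ^ 2 := by gcongr
  have hfrac : lam * γ * η ^ 2 / ΔT * V (k - ΔT)
      ≤ ∑ i ∈ Finset.Ico (k - ΔT) k, ‖θbar i - ϑ i‖ ^ 2 := by
    rw [div_mul_eq_mul_div, div_le_iff₀ hΔT0]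
    linarith
  linarith
end

section
/- Nesterov-acceleration Case 1(b) contraction: suppose 0 < β < 1, 0 < γ ≤ β(2−β)/(8+β²), the regressor is PE with level ε over window ΔT, ‖φ_k‖ ≤ Φ for all k, 0 < λ < 1, η > 0 satisfies γη(1−β) < ε₂ with ε₂ = ε/√(1+Φ²), and k ≥ ΔT. If ‖ϑ_{k−ΔT} − θ*‖² ≥ λγ V_{k−ΔT} and W₁ ≤ η‖ϑ_{k−ΔT} − θ*‖, then V_k ≤ [1 − (9/16)·(ΔT/(1+γΔT)²)·(ε₂ − γη(1−β))²·λγ]·V_{k−ΔT}. -/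
open scoped RealInnerProductSpace

section Tuner

variable {E : Type*} [NormedAddCommGroup E] [InnerProductSpace ℝ E]

lemma norm_add_smul_sq_real (a u : E) (c : ℝ) :
    ‖a + c • u‖ ^ 2 = ‖a‖ ^ 2 + 2 * c * ⟪u, a⟫ + c ^ 2 * ‖u‖ ^ 2 := by
  rw [norm_add_sq_real, inner_smul_right, norm_smul, mul_pow, Real.norm_eq_abs, sq_abs,
    real_inner_comm]
  ring

lemma real_inner_sq_le_of_norm_le_one {u : E} (hu : ‖u‖ ≤ 1) (w : E) :
    ⟪u, w⟫ ^ 2 ≤ ‖w‖ ^ 2 := by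
  rw [sq_le_sq, abs_norm]
  exact (abs_real_inner_le_norm u w).trans (mul_le_of_le_one_left (norm_nonneg w) hu)

/-- Here `t` stands for `⟪u, x + z⟫`, `p` for `⟪u, x⟫`, `q` for `⟪u, y⟫` and `m` for `‖u‖ ^ 2`. -/
lemma tuner_quadratic_form_le {β γ m p q t Y : ℝ} (hβ0 : 0 < β) (hβ1 : β < 1) (hγ0 : 0 < γ)
    (hγ : γ * (8 + β ^ 2) ≤ β * (2 - β)) (hm0 : 0 ≤ m) (hm1 : m ≤ 1)
    (ht : t * (1 - γ * β * m) = p + q) (hY : q ^ 2 ≤ Y) :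
    -(β * (2 - β)) * Y
      + γ * (-2 * (p + (1 - β) * q) * p + 2 * (p + (1 - β) * q) * ((1 - β) * q)
        + 2 * γ * (p + (1 - β) * q) ^ 2 * m - 2 * β * t * q - γ * β ^ 2 * t ^ 2 * m)
      ≤ -(γ * (9 / 16) * p ^ 2) := by
  have hγ8 : γ ≤ 1 / 8 := by nlinarith [sq_nonneg (1 - β), mul_nonneg hγ0.le (sq_nonneg β)]
  have hγm : γ * m ≤ 1 / 8 := by nlinarith
  have hγm0 : 0 ≤ γ * m := by positivity
  have hd : 7 / 8 ≤ 1 - γ * β * m := by nlinarith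
  have ht2 : t ^ 2 ≤ 64 / 49 * (p + q) ^ 2 := by
    rw [← ht]
    have : (7 / 8) ^ 2 ≤ (1 - γ * β * m) ^ 2 := by gcongr
    nlinarith [sq_nonneg t]
  have ht3 : t ^ 2 ≤ 128 / 49 * (p ^ 2 + q ^ 2) := by nlinarith [sq_nonneg (p - q)]
  have hcross : -(2 * β * t * q) ≤ 1 / 4 * t ^ 2 + 4 * q ^ 2 := by
    have : β ^ 2 * q ^ 2 ≤ 1 * q ^ 2 := by
      gcongr
      nlinarith
    nlinarith [sq_nonneg (1 / 2 * t + 2 * (β * q))]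
  have haq : ((1 - β) * q) ^ 2 ≤ q ^ 2 := by
    rw [mul_pow]
    exact mul_le_of_le_one_left (sq_nonneg q) (by nlinarith)
  have hs : 2 * (γ * m) * (p + (1 - β) * q) ^ 2 ≤ 1 / 2 * (p ^ 2 + q ^ 2) := by
    have h1 : (p + (1 - β) * q) ^ 2 ≤ 2 * (p ^ 2 + q ^ 2) := by
      nlinarith [sq_nonneg (p - (1 - β) * q)]
    have := mul_le_mul hγm h1 (sq_nonneg _) (by norm_num)
    linarith
  have hY' : γ * (8 * q ^ 2) ≤ β * (2 - β) * Y := by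
    have h0 : 0 ≤ Y := (sq_nonneg q).trans hY
    calc γ * (8 * q ^ 2) ≤ γ * ((8 + β ^ 2) * Y) := by gcongr; nlinarith [sq_nonneg β]
      _ = γ * (8 + β ^ 2) * Y := by ring
      _ ≤ _ := by gcongr
  have hlast : 0 ≤ γ * m * (β * t) ^ 2 := by positivity
  have hbr : -2 * (p + (1 - β) * q) * p + 2 * (p + (1 - β) * q) * ((1 - β) * q)
      + 2 * γ * (p + (1 - β) * q) ^ 2 * m - 2 * β * t * q - γ * β ^ 2 * t ^ 2 * m
      ≤ 8 * q ^ 2 - 9 / 16 * p ^ 2 := by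
    nlinarith [sq_nonneg p, sq_nonneg q]
  have := mul_le_mul_of_nonneg_left hbr hγ0.le
  linarith

/-- One step of the tuner for the errors `x = ϑ - θ*`, `z = θ - ϑ`, `y = θ̄ - ϑ` and the
normalized regressor `u`. -/
lemma tuner_step_le {β γ : ℝ} (hβ0 : 0 < β) (hβ1 : β < 1) (hγ0 : 0 < γ)
    (hγ : γ * (8 + β ^ 2) ≤ β * (2 - β)) {u x y z x' z' : E} (hu : ‖u‖ ≤ 1)
    (hy : y = z - (γ * β * ⟪u, x + z⟫) • u)
    (hx' : x' = x - (γ * ⟪u, x + (1 - β) • y⟫) • u)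
    (hz' : z' = (1 - β) • y + (γ * ⟪u, x + (1 - β) • y⟫) • u) :
    ‖x'‖ ^ 2 + ‖z'‖ ^ 2 ≤ ‖x‖ ^ 2 + ‖z‖ ^ 2 - γ * (9 / 16) * ⟪u, x⟫ ^ 2 := by
  have hs : ⟪u, x + (1 - β) • y⟫ = ⟪u, x⟫ + (1 - β) * ⟪u, y⟫ := by
    rw [inner_add_right, inner_smul_right]
  have hz : z = y + (γ * β * ⟪u, x + z⟫) • u := by rw [hy]; abel
  have ht : ⟪u, x + z⟫ * (1 - γ * β * ‖u‖ ^ 2) = ⟪u, x⟫ + ⟪u, y⟫ := by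
    rw [hy, inner_sub_right, inner_smul_right, real_inner_self_eq_norm_sq, inner_add_right]
    ring
  have nz : ‖z‖ ^ 2 = ‖y‖ ^ 2 + 2 * (γ * β * ⟪u, x + z⟫) * ⟪u, y⟫
      + (γ * β * ⟪u, x + z⟫) ^ 2 * ‖u‖ ^ 2 := by
    rw [← norm_add_smul_sq_real, ← hz]
  have nx : ‖x'‖ ^ 2 = ‖x‖ ^ 2 + 2 * -(γ * (⟪u, x⟫ + (1 - β) * ⟪u, y⟫)) * ⟪u, x⟫
      + (-(γ * (⟪u, x⟫ + (1 - β) * ⟪u, y⟫))) ^ 2 * ‖u‖ ^ 2 := by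
    rw [hx', sub_eq_add_neg, ← neg_smul, norm_add_smul_sq_real, hs]
  have ny : ‖z'‖ ^ 2 = (1 - β) ^ 2 * ‖y‖ ^ 2
      + 2 * (γ * (⟪u, x⟫ + (1 - β) * ⟪u, y⟫)) * ((1 - β) * ⟪u, y⟫)
      + (γ * (⟪u, x⟫ + (1 - β) * ⟪u, y⟫)) ^ 2 * ‖u‖ ^ 2 := by
    rw [hz', norm_add_smul_sq_real, hs, norm_smul, mul_pow, Real.norm_eq_abs, sq_abs,
      inner_smul_right]
  have key := tuner_quadratic_form_le hβ0 hβ1 hγ0 hγ (sq_nonneg ‖u‖)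
    (pow_le_one₀ (norm_nonneg u) hu) ht (real_inner_sq_le_of_norm_le_one hu y)
  rw [nx, ny, nz]
  linarith

/-- A trajectory driven by `x' = x - γ s u` stays close to its value at the start of a window. -/
lemma norm_sub_le_sum_of_recursion {γ : ℝ} (hγ0 : 0 ≤ γ) {u x : ℕ → E} {s : ℕ → ℝ}
    (hu : ∀ i, ‖u i‖ ≤ 1) (hx : ∀ i, x (i + 1) = x i - (γ * s i) • u i) {a i : ℕ} (hi : a ≤ i) :
    ‖x i - x a‖ ≤ γ * ∑ j ∈ Finset.Ico a i, |s j| := by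
  rw [← Finset.sum_Ico_sub x hi, Finset.mul_sum]
  refine (norm_sum_le _ _).trans (Finset.sum_le_sum fun j _ => ?_)
  rw [hx, sub_sub_cancel_left, norm_neg, norm_smul, Real.norm_eq_abs, abs_mul, abs_of_nonneg hγ0]
  exact mul_le_of_le_one_right (by positivity) (hu j)

lemma sum_abs_inner_start_le {γ : ℝ} (hγ0 : 0 ≤ γ) {u x : ℕ → E} {s : ℕ → ℝ}
    (hu : ∀ i, ‖u i‖ ≤ 1) (hx : ∀ i, x (i + 1) = x i - (γ * s i) • u i) (a b : ℕ) :
    ∑ i ∈ Finset.Ico a b, |⟪u i, x a⟫| ≤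
      ∑ i ∈ Finset.Ico a b, |⟪u i, x i⟫|
        + (b - a : ℕ) * (γ * ∑ j ∈ Finset.Ico a b, |s j|) := by
  rw [← nsmul_eq_mul, ← Nat.card_Ico a b, ← Finset.sum_const, ← Finset.sum_add_distrib]
  refine Finset.sum_le_sum fun i hi => ?_
  obtain ⟨hai, hib⟩ := Finset.mem_Ico.mp hi
  have h1 : ⟪u i, x a⟫ = ⟪u i, x i⟫ - ⟪u i, x i - x a⟫ := by rw [inner_sub_right]; ring
  have h2 : |⟪u i, x i - x a⟫| ≤ γ * ∑ j ∈ Finset.Ico a b, |s j| :=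
    calc |⟪u i, x i - x a⟫| ≤ ‖u i‖ * ‖x i - x a‖ := abs_real_inner_le_norm _ _
      _ ≤ ‖x i - x a‖ := mul_le_of_le_one_left (norm_nonneg _) (hu i)
      _ ≤ γ * ∑ j ∈ Finset.Ico a i, |s j| := norm_sub_le_sum_of_recursion hγ0 hu hx hai
      _ ≤ _ := by
        gcongr
  rw [h1]
  exact (abs_sub _ _).trans (by gcongr)

end Tuner

theorem na_case1b
    (n : ℕ) (hn : 1 ≤ n)
    (θstar : EuclideanSpace ℝ (Fin n))
    (φ θ ϑ θbar : ℕ → EuclideanSpace ℝ (Fin n))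
    (β γ : ℝ) (hβ0 : 0 < β) (hβ1 : β < 1)
    (hγ0 : 0 < γ) (hγ : γ ≤ β * (2 - β) / (8 + β ^ 2))
    (hθbar : ∀ k, θbar k =
      θ k - ((γ * β / (1 + ‖φ k‖ ^ 2)) * ⟪φ k, θ k - θstar⟫) • φ k)
    (hθ : ∀ k, θ (k + 1) = θbar k - β • (θbar k - ϑ k))
    (hϑ : ∀ k, ϑ (k + 1) =
      ϑ k - ((γ / (1 + ‖φ k‖ ^ 2)) * ⟪φ k, θ (k + 1) - θstar⟫) • φ k)
    (V : ℕ → ℝ)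
    (hV : ∀ k, V k = (1 / γ) * ‖ϑ k - θstar‖ ^ 2 + (1 / γ) * ‖θ k - ϑ k‖ ^ 2)
    (ΔT : ℕ) (hΔT : 1 ≤ ΔT) (k : ℕ) (hk : ΔT ≤ k)
    (W₁ W₂ : ℝ)
    (hW₁ : W₁ = ∑ i ∈ Finset.Ico (k - ΔT) k, ‖θbar i - ϑ i‖)
    (hW₂ : W₂ = ∑ i ∈ Finset.Ico (k - ΔT) k,
      (1 / Real.sqrt (1 + ‖φ i‖ ^ 2)) * |⟪φ i, ϑ i - θstar⟫|)
    (ε : ℝ) (hε : 0 < ε)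
    (hPE : ∀ m, ΔT ≤ m → ∀ w : EuclideanSpace ℝ (Fin n), ‖w‖ = 1 →
      ε ≤ (1 / (ΔT : ℝ)) * ∑ i ∈ Finset.Ico (m - ΔT) m, |⟪φ i, w⟫|)
    (Φ : ℝ) (hΦ : ∀ m, ‖φ m‖ ≤ Φ)
    (lam η : ℝ) (hlam0 : 0 < lam) (hlam1 : lam < 1) (hη : 0 < η)
    (hηε : γ * η * (1 - β) < ε / Real.sqrt (1 + Φ ^ 2))
    (hbig : lam * γ * V (k - ΔT) ≤ ‖ϑ (k - ΔT) - θstar‖ ^ 2)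
    (hW1 : W₁ ≤ η * ‖ϑ (k - ΔT) - θstar‖) :
    V k ≤ (1 - (9 / 16) * ((ΔT : ℝ) / (1 + γ * ΔT) ^ 2) *
      (ε / Real.sqrt (1 + Φ ^ 2) - γ * η * (1 - β)) ^ 2 * lam * γ) * V (k - ΔT) := by
  set u : ℕ → EuclideanSpace ℝ (Fin n) := fun i => (1 / √(1 + ‖φ i‖ ^ 2)) • φ i with hu_def
  set x : ℕ → EuclideanSpace ℝ (Fin n) := fun i => ϑ i - θstar with hx_def
  set y : ℕ → EuclideanSpace ℝ (Fin n) := fun i => θbar i - ϑ i with hy_def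
  set z : ℕ → EuclideanSpace ℝ (Fin n) := fun i => θ i - ϑ i with hz_def
  have hN : ∀ i, 0 < 1 + ‖φ i‖ ^ 2 := fun i => by positivity
  have hsmul : ∀ i c w, (c * ⟪u i, w⟫) • u i = ((c / (1 + ‖φ i‖ ^ 2)) * ⟪φ i, w⟫) • φ i := by
    intro i c w
    simp only [hu_def, real_inner_smul_left, smul_smul]
    congr 1
    have h : 1 / √(1 + ‖φ i‖ ^ 2) * (1 / √(1 + ‖φ i‖ ^ 2)) = 1 / (1 + ‖φ i‖ ^ 2) := by
      rw [one_div_mul_one_div, Real.mul_self_sqrt (hN i).le]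
    linear_combination c * ⟪φ i, w⟫ * h
  have hu : ∀ i, ‖u i‖ ≤ 1 := fun i => by
    simp only [hu_def]
    rw [norm_smul, Real.norm_of_nonneg (by positivity), one_div_mul_eq_div,
      div_le_one (Real.sqrt_pos.mpr (hN i))]
    exact Real.le_sqrt_of_sq_le (by linarith)
  have hxz : ∀ i, x i + z i = θ i - θstar := fun i => by simp only [hx_def, hz_def]; abel
  have hxy : ∀ i, x i + (1 - β) • y i = θ (i + 1) - θstar := fun i => by
    simp only [hx_def, hy_def, hθ]; module
  have hy : ∀ i, y i = z i - (γ * β * ⟪u i, x i + z i⟫) • u i := fun i => by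
    rw [hsmul, hxz]; simp only [hy_def, hz_def]; rw [hθbar]; abel
  have hx : ∀ i, x (i + 1) = x i - (γ * ⟪u i, x i + (1 - β) • y i⟫) • u i := fun i => by
    rw [hsmul, hxy]; simp only [hx_def]; rw [hϑ]; abel
  have hz : ∀ i, z (i + 1) = (1 - β) • y i + (γ * ⟪u i, x i + (1 - β) • y i⟫) • u i := fun i => by
    have h1 : z (i + 1) = x i + (1 - β) • y i - x (i + 1) := by
      rw [hxy]; simp only [hx_def, hz_def]; abel
    rw [h1, hx]; abel
  have hγ' : γ * (8 + β ^ 2) ≤ β * (2 - β) := (le_div_iff₀ (by positivity)).mp hγ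
  have hstep : ∀ i, 9 / 16 * ⟪u i, x i⟫ ^ 2 ≤ V i - V (i + 1) := fun i => by
    have h := tuner_step_le hβ0 hβ1 hγ0 hγ' (hu i) (hy i) (hx i) (hz i)
    have hVi : ∀ j, γ * V j = ‖x j‖ ^ 2 + ‖z j‖ ^ 2 := fun j => by
      rw [hV]; field_simp; rfl
    refine le_of_mul_le_mul_left ?_ hγ0
    linarith [hVi i, hVi (i + 1)]
  set a := k - ΔT with ha
  have hak : a ≤ k := Nat.sub_le k ΔT
  have hka : k - a = ΔT := by omega
  have hT : (0 : ℝ) < ΔT := by exact_mod_cast hΔT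
  have hdecr : 9 / 16 * ∑ i ∈ Finset.Ico a k, ⟪u i, x i⟫ ^ 2 ≤ V a - V k := by
    have h := Finset.sum_le_sum fun i (_ : i ∈ Finset.Ico a k) => hstep i
    rw [← Finset.mul_sum] at h
    have h2 := Finset.sum_Ico_sub V hak
    simp only [Finset.sum_sub_distrib] at h h2
    linarith
  have hW₂' : W₂ = ∑ i ∈ Finset.Ico a k, |⟪u i, x i⟫| := by
    rw [hW₂]
    refine Finset.sum_congr rfl fun i _ => ?_
    simp only [hu_def, real_inner_smul_left]
    rw [abs_mul, abs_of_nonneg (by positivity : 0 ≤ 1 / √(1 + ‖φ i‖ ^ 2))]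
  have hcs : W₂ ^ 2 ≤ ΔT * ∑ i ∈ Finset.Ico a k, ⟪u i, x i⟫ ^ 2 := by
    have h := sq_sum_le_card_mul_sum_sq (s := Finset.Ico a k) (f := fun i => |⟪u i, x i⟫|)
    simpa only [← hW₂', Nat.card_Ico, hka, sq_abs] using h
  have hdrift : ∑ i ∈ Finset.Ico a k, |⟪u i, x i + (1 - β) • y i⟫| ≤ W₂ + (1 - β) * W₁ := by
    rw [hW₂', hW₁, Finset.mul_sum, ← Finset.sum_add_distrib]
    refine Finset.sum_le_sum fun i _ => ?_
    rw [inner_add_right, inner_smul_right]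
    refine (abs_add_le _ _).trans ?_
    rw [abs_mul, abs_of_pos (sub_pos.mpr hβ1)]
    have : 0 ≤ 1 - β := by linarith
    gcongr
    exact (abs_real_inner_le_norm _ _).trans (mul_le_of_le_one_left (norm_nonneg _) (hu i))
  set ε₂ := ε / √(1 + Φ ^ 2) with hε₂
  have hexc : ΔT * (ε₂ * ‖x a‖) ≤ ∑ i ∈ Finset.Ico a k, |⟪u i, x a⟫| := by
    rcases eq_or_ne (x a) 0 with h0 | h0
    · simp [h0]
    have hpos : 0 < ‖x a‖ := norm_pos_iff.mpr h0
    have h := hPE k hk (‖x a‖⁻¹ • x a) (norm_smul_inv_norm h0)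
    have h' : ε * ‖x a‖ * ΔT ≤ ∑ i ∈ Finset.Ico a k, |⟪φ i, x a⟫| := by
      simp only [inner_smul_right, abs_mul, abs_of_pos (inv_pos.mpr hpos)] at h
      rw [← Finset.mul_sum, one_div, ← mul_assoc, ← mul_inv, inv_mul_eq_div,
        le_div_iff₀ (by positivity)] at h
      linarith
    calc ΔT * (ε₂ * ‖x a‖) = 1 / √(1 + Φ ^ 2) * (ε * ‖x a‖ * ΔT) := by rw [hε₂]; ring
      _ ≤ 1 / √(1 + Φ ^ 2) * ∑ i ∈ Finset.Ico a k, |⟪φ i, x a⟫| := by gcongr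
      _ = ∑ i ∈ Finset.Ico a k, 1 / √(1 + Φ ^ 2) * |⟪φ i, x a⟫| := Finset.mul_sum ..
      _ ≤ _ := by
        refine Finset.sum_le_sum fun i _ => ?_
        simp only [hu_def, real_inner_smul_left]
        rw [abs_mul, abs_of_nonneg (by positivity : 0 ≤ 1 / √(1 + ‖φ i‖ ^ 2))]
        have := hΦ i
        gcongr
  have hlow : ΔT * ((ε₂ - γ * η * (1 - β)) * ‖x a‖) ≤ (1 + γ * ΔT) * W₂ := by
    have h := sum_abs_inner_start_le hγ0.le hu hx a k
    rw [hka, ← hW₂'] at h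
    have hβ' : 0 ≤ 1 - β := by linarith
    have h2 : ΔT * (γ * ∑ i ∈ Finset.Ico a k, |⟪u i, x i + (1 - β) • y i⟫|)
        ≤ ΔT * (γ * (W₂ + (1 - β) * (η * ‖x a‖))) := by
      gcongr
      exact hdrift.trans (by gcongr)
    linarith
  set d := ε₂ - γ * η * (1 - β) with hd
  have hd0 : 0 < d := sub_pos.mpr hηε
  have hsum : ΔT / (1 + γ * ΔT) ^ 2 * d ^ 2 * ‖x a‖ ^ 2
      ≤ ∑ i ∈ Finset.Ico a k, ⟪u i, x i⟫ ^ 2 := by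
    have h := pow_le_pow_left₀ (by positivity) hlow 2
    refine le_of_mul_le_mul_left ?_ hT
    refine le_trans ?_ hcs
    have hden : 0 < (1 + γ * ΔT) ^ 2 := by positivity
    have e : ΔT * (ΔT / (1 + γ * ΔT) ^ 2 * d ^ 2 * ‖x a‖ ^ 2)
        = (ΔT * (d * ‖x a‖)) ^ 2 / (1 + γ * ΔT) ^ 2 := by ring
    rw [e, div_le_iff₀ hden]
    linarith
  have hfin : ΔT / (1 + γ * ΔT) ^ 2 * d ^ 2 * (lam * γ * V a)
      ≤ ΔT / (1 + γ * ΔT) ^ 2 * d ^ 2 * ‖x a‖ ^ 2 := by gcongr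
  linarith
end
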